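/- arXiv:2111.01957 — 2 statements merged into one kernel-verified Lean document; each statement's English description precedes it below -/
import Mathlib

section
/- Let φ_k, φ be C² convex functions on ℝⁿ with 0 ≤ D²φ_k, D²φ ≤ l·Iₙ and φ_k(0) = φ(0) = 0, with φ_k → φ uniformly on compact sets. Fix t < T and ξ ∈ ℝⁿ, and define E^k, E by E(t,z) = (1/γ)log𝔼[exp(γφ(z+σ(B_T−B_t)))] (similarly for E^k), and let χ^k(t,ξ), χ(t,ξ) be the unique minimizers of z ↦ E^k(t,z) + |σ⁻¹(ξ−z)|²/(2γ(T−t)) (resp. with E). Then χ^k(t,ξ) → χ(t,ξ) and E^k(t,χ^k(t,ξ)) → E(t,χ(t,ξ)). -/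
open MeasureTheory
open scoped RealInnerProductSpace

/-- The law of the Brownian increment `B_T - B_t`: `n`-fold product of `N(0, s)`,
`s = T - t`, as a measure on `EuclideanSpace ℝ (Fin n)`. -/
noncomputable def gaussVec (n : ℕ) (s : ℝ) : Measure (EuclideanSpace ℝ (Fin n)) :=
  (Measure.pi fun _ : Fin n => ProbabilityTheory.gaussianReal 0 s.toNNReal).map
    (EuclideanSpace.equiv (Fin n) ℝ).symm

open Filter Topology

lemma aux_one_dim (g g' g'' : ℝ → ℝ) (M : ℝ) (h1 : ∀ s, HasDerivAt g (g' s) s)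
    (h2 : ∀ s, HasDerivAt g' (g'' s) s) (h3 : ∀ s, 0 ≤ g'' s) (h4 : ∀ s, g'' s ≤ M) :
    g' 0 ≤ g 1 - g 0 ∧ g 1 - g 0 ≤ g' 0 + M / 2 := by
  have mono1 : Monotone g' := monotone_of_hasDerivAt_nonneg h2 h3
  have mono2 : Monotone (fun s => M * s - g' s) :=
    monotone_of_hasDerivAt_nonneg (f' := fun s => M * 1 - g'' s)
      (fun s => ((hasDerivAt_id s).const_mul M).sub (h2 s))
      (fun s => by have := h4 s; simp; linarith)
  have h01 : (0:ℝ) ∈ Set.Icc (0:ℝ) 1 := by simp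
  have h11 : (1:ℝ) ∈ Set.Icc (0:ℝ) 1 := by simp
  constructor
  · have hd : ∀ s, HasDerivAt (fun s => g s - g' 0 * s) (g' s - g' 0 * 1) s :=
      fun s => (h1 s).sub ((hasDerivAt_id s).const_mul (g' 0))
    have := monotoneOn_of_deriv_nonneg (convex_Icc (0:ℝ) 1)
      (f := fun s => g s - g' 0 * s)
      (fun s _ => (hd s).continuousAt.continuousWithinAt)
      (fun s _ => (hd s).differentiableAt.differentiableWithinAt)
      (fun s hs => by
        rw [(hd s).deriv]
        rw [interior_Icc] at hs
        have := mono1 hs.1.le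
        linarith) h01 h11 zero_le_one
    simp at this
    linarith
  · have hd : ∀ s, HasDerivAt (fun s => g' 0 * s + M / 2 * s ^ 2 - g s)
        (g' 0 * 1 + M / 2 * (2 * s) - g' s) s := fun s => by
      have hsq : HasDerivAt (fun s : ℝ => s ^ 2) (2 * s) s := by
        simpa using hasDerivAt_pow 2 s
      exact (((hasDerivAt_id s).const_mul (g' 0)).add (hsq.const_mul (M/2))).sub (h1 s)
    have := monotoneOn_of_deriv_nonneg (convex_Icc (0:ℝ) 1)
      (f := fun s => g' 0 * s + M / 2 * s ^ 2 - g s)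
      (fun s _ => (hd s).continuousAt.continuousWithinAt)
      (fun s _ => (hd s).differentiableAt.differentiableWithinAt)
      (fun s hs => by
        rw [(hd s).deriv]
        rw [interior_Icc] at hs
        have := mono2 hs.1.le
        simp at this
        linarith) h01 h11 zero_le_one
    simp at this
    linarith

lemma aux_quad {n : ℕ} (f : EuclideanSpace ℝ (Fin n) → ℝ) (l : ℝ)
    (hf : ContDiff ℝ 2 f ∧ f 0 = 0 ∧
      ∀ z v, 0 ≤ ⟪fderiv ℝ (gradient f) z v, v⟫ ∧
        ⟪fderiv ℝ (gradient f) z v, v⟫ ≤ l * ‖v‖ ^ 2) (x : EuclideanSpace ℝ (Fin n)) :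
    ⟪gradient f 0, x⟫ ≤ f x ∧ f x ≤ ⟪gradient f 0, x⟫ + l * ‖x‖ ^ 2 / 2 := by
  obtain ⟨hc, h0, hH⟩ := hf
  have hd : Differentiable ℝ f := hc.differentiable (by norm_num)
  have hgd : Differentiable ℝ (gradient f) := by
    have h1 : ContDiff ℝ 1 (fderiv ℝ f) := hc.fderiv_right (by norm_num)
    have h2 : Differentiable ℝ (fderiv ℝ f) := h1.differentiable (by norm_num)
    have : gradient f = fun z => (InnerProductSpace.toDual ℝ _).symm (fderiv ℝ f z) := rfl
    rw [this]
    exact ((InnerProductSpace.toDual ℝ (EuclideanSpace ℝ (Fin n))).symm.toContinuousLinearEquiv.differentiable).comp h2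
  have hline : ∀ s : ℝ, HasDerivAt (fun s : ℝ => s • x) x s := fun s => by
    simpa using (hasDerivAt_id s).smul_const x
  have := aux_one_dim (fun s => f (s • x)) (fun s => ⟪gradient f (s • x), x⟫)
    (fun s => ⟪fderiv ℝ (gradient f) (s • x) x, x⟫) (l * ‖x‖ ^ 2)
    (fun s => by
      have h := (hd (s • x)).hasFDerivAt.comp_hasDerivAt s (hline s)
      have e : ⟪gradient f (s • x), x⟫ = fderiv ℝ f (s • x) x := by
        simp [gradient]
      rw [e]; exact h)
    (fun s => by
      have h := (hgd (s • x)).hasFDerivAt.comp_hasDerivAt s (hline s)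
      have h2 := h.inner ℝ (hasDerivAt_const s x)
      simpa using h2)
    (fun s => (hH _ _).1) (fun s => (hH _ _).2)
  simpa [h0] using this

lemma aux_bound {n : ℕ} (f : EuclideanSpace ℝ (Fin n) → ℝ) (l C : ℝ) (hC : 0 ≤ C)
    (hf : ContDiff ℝ 2 f ∧ f 0 = 0 ∧
      ∀ z v, 0 ≤ ⟪fderiv ℝ (gradient f) z v, v⟫ ∧
        ⟪fderiv ℝ (gradient f) z v, v⟫ ≤ l * ‖v‖ ^ 2)
    (hb : ∀ x ∈ Metric.closedBall (0 : EuclideanSpace ℝ (Fin n)) 1, f x ≤ C)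
    (x : EuclideanSpace ℝ (Fin n)) :
    -(C * ‖x‖) ≤ f x ∧ f x ≤ C * ‖x‖ + l * ‖x‖ ^ 2 / 2 := by
  have hp : ‖gradient f 0‖ ≤ C := by
    set p := gradient f 0 with hpdef
    rcases eq_or_ne p 0 with h | h
    · rw [h]; simpa using hC
    · have hn : ‖p‖ ≠ 0 := norm_ne_zero_iff.2 h
      have h1 := (aux_quad f l hf (‖p‖⁻¹ • p)).1
      have h2 := hb (‖p‖⁻¹ • p) (by simp [norm_smul, hn])
      rw [← hpdef, inner_smul_right, real_inner_self_eq_norm_sq] at h1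
      have : ‖p‖⁻¹ * ‖p‖ ^ 2 = ‖p‖ := by field_simp
      linarith
  obtain ⟨h1, h2⟩ := aux_quad f l hf x
  have h3 := abs_le.1 ((abs_real_inner_le_norm (gradient f 0) x).trans
    (mul_le_mul_of_nonneg_right hp (norm_nonneg x)))
  constructor <;> linarith [h3.1, h3.2]

lemma aux_gauss1 (s : ℝ) (hs : 0 < s) (a : ℝ) (ha : a < 1 / (2 * s)) :
    Integrable (fun x : ℝ => Real.exp (a * x ^ 2))
      (ProbabilityTheory.gaussianReal 0 s.toNNReal) := by
  have hs' : s.toNNReal ≠ 0 := by simpa using hs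
  rw [ProbabilityTheory.gaussianReal_of_var_ne_zero _ hs',
    integrable_withDensity_iff_integrable_smul₀'
      (ProbabilityTheory.measurable_gaussianPDF _ _).aemeasurable
      (by simp [ProbabilityTheory.gaussianPDF])]
  have := (integrable_exp_neg_mul_sq (b := 1 / (2 * s) - a) (by linarith)).const_mul
    ((√(2 * Real.pi * s))⁻¹)
  refine this.congr (Filter.Eventually.of_forall fun x => ?_)
  have e : (ProbabilityTheory.gaussianPDF 0 s.toNNReal x).toReal
      = (√(2 * Real.pi * s))⁻¹ * Real.exp (-(x ^ 2) / (2 * s)) := by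
    rw [ProbabilityTheory.toReal_gaussianPDF, ProbabilityTheory.gaussianPDFReal]
    simp [hs.le]
  simp only [smul_eq_mul]
  rw [e, mul_assoc (√(2 * Real.pi * s))⁻¹, ← Real.exp_add]
  congr 2
  field_simp
  ring

lemma aux_gaussN {n : ℕ} (s : ℝ) (hs : 0 < s) (a : ℝ) (ha : a < 1 / (2 * s)) :
    Integrable (fun x : EuclideanSpace ℝ (Fin n) => Real.exp (a * ‖x‖ ^ 2)) (gaussVec n s) := by
  unfold gaussVec
  have hm : Measurable (EuclideanSpace.equiv (Fin n) ℝ).symm :=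
    (EuclideanSpace.equiv (Fin n) ℝ).symm.continuous.measurable
  rw [integrable_map_measure (by fun_prop) hm.aemeasurable]
  have := Integrable.fintype_prod (μ := fun _ : Fin n => ProbabilityTheory.gaussianReal 0 s.toNNReal)
    (f := fun (_ : Fin n) (x : ℝ) => Real.exp (a * x ^ 2)) (fun i => aux_gauss1 s hs a ha)
  refine this.congr (Filter.Eventually.of_forall fun x => ?_)
  simp [EuclideanSpace.norm_sq_eq, ← Real.exp_sum, Finset.mul_sum]

instance aux_prob {n : ℕ} (s : ℝ) : IsProbabilityMeasure (gaussVec n s) := by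
  unfold gaussVec
  have hm : Measurable (EuclideanSpace.equiv (Fin n) ℝ).symm :=
    (EuclideanSpace.equiv (Fin n) ℝ).symm.continuous.measurable
  exact Measure.isProbabilityMeasure_map hm.aemeasurable

/-- `A r² + B r + D ≤ a r² + b` for `A < a`. -/
lemma aux_absorb (A B D a : ℝ) (h : A < a) :
    ∃ b, ∀ r : ℝ, A * r ^ 2 + B * r + D ≤ a * r ^ 2 + b := by
  refine ⟨D + B ^ 2 / (4 * (a - A)), fun r => ?_⟩
  have h1 : 0 < a - A := by linarith
  have h2 : 0 ≤ (2 * (a - A) * r - B) ^ 2 / (4 * (a - A)) := by positivity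
  have h3 : (2 * (a - A) * r - B) ^ 2 / (4 * (a - A))
    = (a - A) * r ^ 2 - B * r + B ^ 2 / (4 * (a - A)) := by field_simp; ring
  linarith

lemma aux_dom {n : ℕ}
    (σ : EuclideanSpace ℝ (Fin n) ≃L[ℝ] EuclideanSpace ℝ (Fin n))
    (γ s l lam C R : ℝ) (hγ : 0 < γ) (hs : 0 < s) (hl : 0 ≤ l) (hC : 0 ≤ C) (hR : 0 ≤ R)
    (hlam : ∀ v, ‖σ v‖ ≤ lam * ‖v‖) (hsmall : l * γ * lam ^ 2 * s < 1) :
    Integrable (fun w => Real.exp (γ * (C * (R + ‖w‖) + l * (R + ‖w‖) ^ 2 / 2)))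
      ((gaussVec n s).map σ) := by
  have hm : Measurable σ := σ.continuous.measurable
  rw [integrable_map_measure (by fun_prop) hm.aemeasurable]
  have hA : γ * l * lam ^ 2 / 2 < 1 / (2 * s) := by
    rw [lt_div_iff₀ (by positivity)]; linarith
  obtain ⟨a, ha1, ha2⟩ := exists_between hA
  obtain ⟨b, hb⟩ := aux_absorb (γ * l * lam ^ 2 / 2) (γ * (C * lam + l * R * lam))
    (γ * (C * R + l * R ^ 2 / 2)) a ha1
  refine ((aux_gaussN s hs a ha2).mul_const (Real.exp b)).mono' (by fun_prop)
    (Filter.Eventually.of_forall fun v => ?_)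
  simp only [Function.comp, Real.norm_eq_abs, Real.abs_exp]
  rw [← Real.exp_add, Real.exp_le_exp]
  refine le_trans ?_ (hb ‖v‖)
  have h1 := hlam v
  calc γ * (C * (R + ‖σ v‖) + l * (R + ‖σ v‖) ^ 2 / 2)
      ≤ γ * (C * (R + lam * ‖v‖) + l * (R + lam * ‖v‖) ^ 2 / 2) := by gcongr
    _ = _ := by ring

/-- Continuous convergence. -/
lemma aux_conv {n : ℕ} (μ : Measure (EuclideanSpace ℝ (Fin n))) [IsProbabilityMeasure μ]
    (γ l C : ℝ) (hγ : 0 < γ) (hl : 0 ≤ l) (hC : 0 ≤ C)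
    (hdom : ∀ R, 0 ≤ R →
      Integrable (fun w => Real.exp (γ * (C * (R + ‖w‖) + l * (R + ‖w‖) ^ 2 / 2))) μ)
    (φs : ℕ → EuclideanSpace ℝ (Fin n) → ℝ) (φ : EuclideanSpace ℝ (Fin n) → ℝ)
    (hφs : ∀ k, Continuous (φs k)) (hφ : Continuous φ)
    (hb : ∀ᶠ k in atTop, ∀ x, φs k x ≤ C * ‖x‖ + l * ‖x‖ ^ 2 / 2)
    (hcv : TendstoLocallyUniformly φs φ Filter.atTop)
    (hint : ∀ z, Integrable (fun w => Real.exp (γ * φ (z + w))) μ)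
    (ns : ℕ → ℕ) (hns : Tendsto ns atTop atTop) (z : ℕ → EuclideanSpace ℝ (Fin n))
    (z0 : EuclideanSpace ℝ (Fin n)) (hz : Tendsto z atTop (𝓝 z0)) :
    Tendsto (fun j => (1 / γ) * Real.log (∫ w, Real.exp (γ * φs (ns j) (z j + w)) ∂μ)) atTop
      (𝓝 ((1 / γ) * Real.log (∫ w, Real.exp (γ * φ (z0 + w)) ∂μ))) := by
  refine Tendsto.const_mul _ (Tendsto.log ?_ (integral_exp_pos (hint z0)).ne')
  refine tendsto_integral_filter_of_dominated_convergence
    (fun w => Real.exp (γ * (C * ((‖z0‖ + 1) + ‖w‖) + l * ((‖z0‖ + 1) + ‖w‖) ^ 2 / 2)))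
    ?_ ?_ (hdom _ (by positivity)) ?_
  · refine Eventually.of_forall fun j => ?_
    have := hφs (ns j)
    exact Continuous.aestronglyMeasurable (by fun_prop)
  · have hz1 : ∀ᶠ j in atTop, ‖z j‖ < ‖z0‖ + 1 := hz.norm.eventually_lt_const (by linarith)
    filter_upwards [hns.eventually hb, hz1] with j h1 h2
    refine Eventually.of_forall fun w => ?_
    rw [Real.norm_eq_abs, Real.abs_exp, Real.exp_le_exp]
    have h3 : ‖z j + w‖ ≤ (‖z0‖ + 1) + ‖w‖ := (norm_add_le _ _).trans (by linarith)
    gcongr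
    refine (h1 _).trans ?_
    gcongr
  · refine Eventually.of_forall fun w => ?_
    have : Tendsto (fun j => φs (ns j) (z j + w)) atTop (𝓝 (φ (z0 + w))) := by
      refine tendsto_comp_of_locally_uniform_limit (F := fun j => φs (ns j)) hφ.continuousAt
        (hz.add_const w) fun u hu => ?_
      obtain ⟨t, ht, h⟩ := hcv u hu (z0 + w)
      exact ⟨t, ht, hns.eventually h⟩
    exact (Real.continuous_exp.tendsto _).comp (this.const_mul γ)

lemma aux_lower {n : ℕ} (μ : Measure (EuclideanSpace ℝ (Fin n))) [IsProbabilityMeasure μ]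
    (γ C : ℝ) (hγ : 0 < γ) (hC : 0 ≤ C) :
    ∃ D, ∀ (f : EuclideanSpace ℝ (Fin n) → ℝ), (∀ x, -(C * ‖x‖) ≤ f x) →
      (∀ z, Integrable (fun w => Real.exp (γ * f (z + w))) μ) → ∀ z,
      -(C * ‖z‖) - D ≤ (1 / γ) * Real.log (∫ w, Real.exp (γ * f (z + w)) ∂μ) := by
  have hi : Integrable (fun w : EuclideanSpace ℝ (Fin n) => Real.exp (-(γ * (C * ‖w‖)))) μ := by
    refine (integrable_const (1:ℝ)).mono' (by fun_prop) (Eventually.of_forall fun w => ?_)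
    rw [Real.norm_eq_abs, Real.abs_exp, Real.exp_le_one_iff]
    have : 0 ≤ γ * (C * ‖w‖) := by positivity
    linarith
  have hpos := integral_exp_pos hi
  refine ⟨-(1 / γ * Real.log (∫ w, Real.exp (-(γ * (C * ‖w‖))) ∂μ)), fun f hf hfi z => ?_⟩
  have h1 : Real.exp (-(γ * (C * ‖z‖))) * ∫ w, Real.exp (-(γ * (C * ‖w‖))) ∂μ
      ≤ ∫ w, Real.exp (γ * f (z + w)) ∂μ := by
    rw [← integral_const_mul]
    refine integral_mono (hi.const_mul _) (hfi z) fun w => ?_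
    simp only
    rw [← Real.exp_add, Real.exp_le_exp]
    have h2 := hf (z + w)
    have h3 : C * ‖z + w‖ ≤ C * (‖z‖ + ‖w‖) := by gcongr; exact norm_add_le _ _
    have h4 : γ * (-(C * (‖z‖ + ‖w‖))) ≤ γ * f (z + w) := by gcongr; linarith
    linarith
  have h2 := Real.log_le_log (by positivity) h1
  rw [Real.log_mul (Real.exp_pos _).ne' hpos.ne', Real.log_exp] at h2
  have h3 := mul_le_mul_of_nonneg_left h2 (by positivity : 0 ≤ 1 / γ)
  have h4 : 1 / γ * (-(γ * (C * ‖z‖)) + Real.log (∫ w, Real.exp (-(γ * (C * ‖w‖))) ∂μ))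
    = -(C * ‖z‖) + 1 / γ * Real.log (∫ w, Real.exp (-(γ * (C * ‖w‖))) ∂μ) := by
    field_simp
  linarith

/-- Continuous dependence of the minimizers: if `φ_k → φ` in `C_l` uniformly on
compact sets, then at each fixed `(t, ξ)` the minimizers `χ^k(t,ξ)` of
`z ↦ E^k(t,z) + |σ⁻¹(ξ−z)|²/(2γ(T−t))` converge to `χ(t,ξ)` and
`E^k(t,χ^k(t,ξ)) → E(t,χ(t,ξ))`. -/
theorem stmt7 {n : ℕ}
    (σ : EuclideanSpace ℝ (Fin n) ≃L[ℝ] EuclideanSpace ℝ (Fin n))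
    (hσsym : ∀ v w, ⟪σ v, w⟫ = ⟪v, σ w⟫)
    (hσpos : ∀ v, v ≠ 0 → 0 < ⟪σ v, v⟫)
    (γ T l t lam : ℝ) (hγ : 0 < γ) (hT : 0 < T) (hl : 0 ≤ l)
    (ht : 0 ≤ t) (htT : t < T)
    (hlam : ∀ v, ‖σ v‖ ≤ lam * ‖v‖) (hsmall : l * γ * lam ^ 2 * T < 1)
    (φs : ℕ → EuclideanSpace ℝ (Fin n) → ℝ) (φ : EuclideanSpace ℝ (Fin n) → ℝ)
    (hφsC : ∀ k, ContDiff ℝ 2 (φs k) ∧ φs k 0 = 0 ∧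
      ∀ z v, 0 ≤ ⟪fderiv ℝ (gradient (φs k)) z v, v⟫ ∧
        ⟪fderiv ℝ (gradient (φs k)) z v, v⟫ ≤ l * ‖v‖ ^ 2)
    (hφC : ContDiff ℝ 2 φ ∧ φ 0 = 0 ∧
      ∀ z v, 0 ≤ ⟪fderiv ℝ (gradient φ) z v, v⟫ ∧
        ⟪fderiv ℝ (gradient φ) z v, v⟫ ≤ l * ‖v‖ ^ 2)
    (hcv : TendstoLocallyUniformly φs φ Filter.atTop)
    (μ : Measure (EuclideanSpace ℝ (Fin n))) (hμ : μ = (gaussVec n (T - t)).map σ)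
    (hintk : ∀ k z, Integrable (fun w => Real.exp (γ * φs k (z + w))) μ)
    (hint : ∀ z, Integrable (fun w => Real.exp (γ * φ (z + w))) μ)
    (Ek : ℕ → EuclideanSpace ℝ (Fin n) → ℝ)
    (hEk : Ek = fun k z => (1 / γ) * Real.log (∫ w, Real.exp (γ * φs k (z + w)) ∂μ))
    (Efn : EuclideanSpace ℝ (Fin n) → ℝ)
    (hEfn : Efn = fun z => (1 / γ) * Real.log (∫ w, Real.exp (γ * φ (z + w)) ∂μ))
    (ξ : EuclideanSpace ℝ (Fin n))
    (χk : ℕ → EuclideanSpace ℝ (Fin n))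
    (hχk : ∀ k, IsMinOn
      (fun z => Ek k z + ‖σ.symm (ξ - z)‖ ^ 2 / (2 * γ * (T - t))) Set.univ (χk k))
    (hχku : ∀ k z, IsMinOn
      (fun z' => Ek k z' + ‖σ.symm (ξ - z')‖ ^ 2 / (2 * γ * (T - t))) Set.univ z → z = χk k)
    (χs : EuclideanSpace ℝ (Fin n))
    (hχ : IsMinOn
      (fun z => Efn z + ‖σ.symm (ξ - z)‖ ^ 2 / (2 * γ * (T - t))) Set.univ χs)
    (hχu : ∀ z, IsMinOn
      (fun z' => Efn z' + ‖σ.symm (ξ - z')‖ ^ 2 / (2 * γ * (T - t))) Set.univ z → z = χs) :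
    Filter.Tendsto χk Filter.atTop (nhds χs) ∧
      Filter.Tendsto (fun k => Ek k (χk k)) Filter.atTop (nhds (Efn χs)) := by
  have hs : 0 < T - t := by linarith
  have hsm : l * γ * lam ^ 2 * (T - t) < 1 := by
    refine lt_of_le_of_lt ?_ hsmall
    gcongr
    linarith
  have hprob : IsProbabilityMeasure μ := by
    rw [hμ]
    exact Measure.isProbabilityMeasure_map σ.continuous.measurable.aemeasurable
  have hφc : Continuous φ := hφC.1.continuous
  -- uniform bound
  obtain ⟨C, hC, hbd⟩ : ∃ C : ℝ, 0 ≤ C ∧ ∀ᶠ k in atTop, ∀ x,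
      -(C * ‖x‖) ≤ φs k x ∧ φs k x ≤ C * ‖x‖ + l * ‖x‖ ^ 2 / 2 := by
    have hK := isCompact_closedBall (0 : EuclideanSpace ℝ (Fin n)) 1
    obtain ⟨C0, hC0⟩ := hK.exists_bound_of_continuousOn hφc.continuousOn
    have hC00 : 0 ≤ C0 := (norm_nonneg _).trans (hC0 0 (by simp))
    refine ⟨C0 + 1, by linarith, ?_⟩
    have hu := (tendstoLocallyUniformlyOn_iff_tendstoUniformlyOn_of_compact hK).1
      (hcv.tendstoLocallyUniformlyOn (s := Metric.closedBall 0 1))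
    filter_upwards [Metric.tendstoUniformlyOn_iff.1 hu 1 one_pos] with k hk
    refine aux_bound (φs k) l (C0 + 1) (by linarith) (hφsC k) fun x hx => ?_
    have h1 := hk x hx
    have h2 := hC0 x hx
    rw [Real.dist_eq, abs_lt] at h1
    rw [Real.norm_eq_abs, abs_le] at h2
    linarith [h1.1, h2.2]
  have hdom : ∀ R, 0 ≤ R →
      Integrable (fun w => Real.exp (γ * (C * (R + ‖w‖) + l * (R + ‖w‖) ^ 2 / 2))) μ := by
    intro R hR
    rw [hμ]
    exact aux_dom σ γ (T - t) l lam C R hγ hs hl hC hR hlam hsm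
  have hconv : ∀ ns : ℕ → ℕ, Tendsto ns atTop atTop →
      ∀ (z : ℕ → EuclideanSpace ℝ (Fin n)) z0, Tendsto z atTop (𝓝 z0) →
      Tendsto (fun j => Ek (ns j) (z j)) atTop (𝓝 (Efn z0)) := by
    intro ns hns z z0 hz
    rw [hEk, hEfn]
    exact aux_conv μ γ l C hγ hl hC hdom φs φ (fun k => (hφsC k).1.continuous) hφc
      (hbd.mono fun k h x => (h x).2) hcv hint ns hns z z0 hz
  -- boundedness of the minimizers
  obtain ⟨D, hD⟩ := aux_lower μ γ C hγ hC
  have hlow : ∀ᶠ k in atTop, ∀ z, -(C * ‖z‖) - D ≤ Ek k z := by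
    filter_upwards [hbd] with k hk z
    rw [hEk]
    exact hD (φs k) (fun x => (hk x).1) (hintk k) z
  obtain ⟨q, hq, hqb⟩ : ∃ q : ℝ, 0 < q ∧
      ∀ y, q * ‖y‖ ^ 2 ≤ ‖σ.symm y‖ ^ 2 / (2 * γ * (T - t)) := by
    set L : ℝ := ‖(σ : EuclideanSpace ℝ (Fin n) →L[ℝ] EuclideanSpace ℝ (Fin n))‖ + 1 with hL
    have hLpos : 0 < L := by positivity
    refine ⟨1 / (L ^ 2 * (2 * γ * (T - t))), by positivity, fun y => ?_⟩
    have h1 : ‖y‖ ≤ L * ‖σ.symm y‖ := by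
      have := (σ : EuclideanSpace ℝ (Fin n) →L[ℝ] EuclideanSpace ℝ (Fin n)).le_opNorm (σ.symm y)
      simp at this
      have h0 := norm_nonneg (σ.symm y)
      rw [hL]; linarith
    have h2 : ‖y‖ ^ 2 ≤ L ^ 2 * ‖σ.symm y‖ ^ 2 := by
      rw [← mul_pow]; gcongr
    calc 1 / (L ^ 2 * (2 * γ * (T - t))) * ‖y‖ ^ 2
        ≤ 1 / (L ^ 2 * (2 * γ * (T - t))) * (L ^ 2 * ‖σ.symm y‖ ^ 2) := by gcongr
      _ = _ := by field_simp
  have hbdd : ∃ R, ∀ᶠ k in atTop, χk k ∈ Metric.closedBall ξ R := by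
    have hξ : ∀ᶠ k in atTop, Ek k ξ < Efn ξ + 1 :=
      (hconv id tendsto_id (fun _ => ξ) ξ tendsto_const_nhds).eventually_lt_const (by linarith)
    set A : ℝ := |Efn ξ + 1 + D + C * ‖ξ‖| with hA
    have hA0 : 0 ≤ A := abs_nonneg _
    refine ⟨1 + (A + C) / q, ?_⟩
    filter_upwards [hξ, hlow] with k h1 h2
    rw [Metric.mem_closedBall, dist_comm, dist_eq_norm]
    have h3 := isMinOn_iff.1 (hχk k) ξ (Set.mem_univ _)
    simp at h3
    have h4 := hqb (ξ - χk k)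
    rw [map_sub] at h4
    have h5 := h2 (χk k)
    have h6 : ‖χk k‖ ≤ ‖ξ‖ + ‖ξ - χk k‖ := by
      have := norm_sub_le ξ (ξ - χk k)
      simpa using this
    have h7 : C * ‖χk k‖ ≤ C * (‖ξ‖ + ‖ξ - χk k‖) := by gcongr
    set r := ‖ξ - χk k‖ with hr
    have hr0 : 0 ≤ r := norm_nonneg _
    have h8 : q * r ^ 2 ≤ A + C * r := by
      have := le_abs_self (Efn ξ + 1 + D + C * ‖ξ‖)
      linarith
    have hq0 : 0 ≤ (A + C) / q := by positivity
    rcases le_total r 1 with h | h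
    · linarith
    · have : r ≤ (A + C) / q := by
        rw [le_div_iff₀ hq]
        have h9 : q * r ^ 2 ≤ (A + C) * r := by nlinarith
        have : (r * q) * r ≤ (A + C) * r := by linarith
        exact le_of_mul_le_mul_right this (by linarith)
      linarith
  obtain ⟨R, hR⟩ := hbdd
  have hmain : Tendsto χk atTop (𝓝 χs) := by
    refine tendsto_of_subseq_tendsto fun ns hns => ?_
    obtain ⟨a, -, ms, hms, hlim⟩ := (isCompact_closedBall ξ R).tendsto_subseq'
      (x := fun j => χk (ns j)) (hns.eventually hR).frequently
    refine ⟨ms, ?_⟩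
    have hnm : Tendsto (fun j => ns (ms j)) atTop atTop := hns.comp hms.tendsto_atTop
    have ha : a = χs := by
      refine hχu a (isMinOn_iff.2 fun z _ => ?_)
      have hQ : Continuous fun z => ‖σ.symm (ξ - z)‖ ^ 2 / (2 * γ * (T - t)) := by fun_prop
      have l1 := (hconv _ hnm _ a hlim).add ((hQ.tendsto a).comp hlim)
      have l2 := (hconv _ hnm (fun _ => z) z tendsto_const_nhds).add_const
        (‖σ.symm (ξ - z)‖ ^ 2 / (2 * γ * (T - t)))
      exact le_of_tendsto_of_tendsto' l1 l2
        fun j => isMinOn_iff.1 (hχk (ns (ms j))) z (Set.mem_univ _)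
    rw [← ha]
    exact hlim
  exact ⟨hmain, hconv id tendsto_id χk χs hmain⟩
end

section
/- (Caffarelli-type contraction bound applied in the fixed point.) Let μ have density G on ℝⁿ satisfying −vᵀD²(log G)(y)v ≤ |v|²/(λ̄²(σ)T) for all v, y, and let ν be κ-strongly log-concave. If ψ is the convex Brenier potential with (Dψ)_♯μ = ν, then the largest eigenvalue of D²ψ satisfies λ̄(D²ψ) ≤ 1/√(λ̄²(σ)Tκ). -/
open MeasureTheory
open scoped RealInnerProductSpace

set_option linter.unusedSectionVars false

section Caff

variable {E : Type*} [NormedAddCommGroup E] [InnerProductSpace ℝ E] [FiniteDimensional ℝ E]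

theorem cf_contDiff_gradient {f : E → ℝ} (hf : ContDiff ℝ 2 f) : ContDiff ℝ 1 (gradient f) := by
  have h1 : ContDiff ℝ 1 (fderiv ℝ f) := hf.fderiv_right (by norm_num)
  exact (InnerProductSpace.toDual ℝ E).symm.toContinuousLinearEquiv.contDiff.comp h1

theorem cf_hess_inner {f : E → ℝ} (hf : ContDiff ℝ 2 f) (x v w : E) :
    ⟪fderiv ℝ (gradient f) x v, w⟫ = fderiv ℝ (fderiv ℝ f) x v w := by
  have hd : DifferentiableAt ℝ (gradient f) x :=
    (cf_contDiff_gradient hf).differentiable (by norm_num) x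
  have h1 : DifferentiableAt ℝ (fderiv ℝ f) x :=
    (hf.fderiv_right (m := 1) (by norm_num)).differentiable (by norm_num) x
  have e1 : HasFDerivAt (fun y => ⟪gradient f y, w⟫)
      ((innerSL ℝ w).comp (fderiv ℝ (gradient f) x)) x := by
    have := (innerSL ℝ w).hasFDerivAt.comp x hd.hasFDerivAt
    refine this.congr_of_eventuallyEq (Filter.Eventually.of_forall fun y => ?_)
    simp
  have e2 : HasFDerivAt (fun y => ⟪gradient f y, w⟫)
      ((ContinuousLinearMap.apply ℝ ℝ w).comp (fderiv ℝ (fderiv ℝ f) x)) x := by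
    have := (ContinuousLinearMap.apply ℝ ℝ w).hasFDerivAt.comp x h1.hasFDerivAt
    refine this.congr_of_eventuallyEq (Filter.Eventually.of_forall fun y => ?_)
    simp [inner_gradient_left]
  have := congrArg (fun L => L v) (e1.unique e2)
  simp only [ContinuousLinearMap.comp_apply, innerSL_apply_apply, ContinuousLinearMap.apply_apply] at this
  rw [← this, real_inner_comm]

theorem cf_hess_symm {f : E → ℝ} (hf : ContDiff ℝ 2 f) (x v w : E) :
    ⟪fderiv ℝ (gradient f) x v, w⟫ = ⟪v, fderiv ℝ (gradient f) x w⟫ := by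
  rw [cf_hess_inner hf, real_inner_comm, cf_hess_inner hf]
  have h1 : ContDiff ℝ 1 (fderiv ℝ f) := hf.fderiv_right (by norm_num)
  exact second_derivative_symmetric
    (fun y => ((hf.differentiable (by norm_num)) y).hasFDerivAt)
    ((h1.differentiable (by norm_num)) x).hasFDerivAt v w

theorem cf_line_deriv {f : E → ℝ} (hf : ContDiff ℝ 2 f) (q d : E) (t : ℝ) :
    HasDerivAt (fun t : ℝ => f (q + t • d)) ⟪gradient f (q + t • d), d⟫ t := by
  have h1 : HasDerivAt (fun t : ℝ => q + t • d) d t := by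
    simpa using ((hasDerivAt_id t).smul_const d).const_add q
  have := ((hf.differentiable (by norm_num)) (q + t • d)).hasFDerivAt.comp_hasDerivAt t h1
  rw [inner_gradient_left]
  exact this

theorem cf_line_deriv2 {f : E → ℝ} (hf : ContDiff ℝ 2 f) (q d : E) (t : ℝ) :
    HasDerivAt (fun t : ℝ => ⟪gradient f (q + t • d), d⟫)
      ⟪fderiv ℝ (gradient f) (q + t • d) d, d⟫ t := by
  have h1 : HasDerivAt (fun t : ℝ => q + t • d) d t := by
    simpa using ((hasDerivAt_id t).smul_const d).const_add q
  have := (((cf_contDiff_gradient hf).differentiable (by norm_num)) (q + t • d)).hasFDerivAt.comp_hasDerivAt t h1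
  have h3 := this.inner ℝ (hasDerivAt_const t d)
  simpa using h3

theorem cf_taylor {f : E → ℝ} (hf : ContDiff ℝ 2 f) {m : ℝ}
    (hm : ∀ x v, m * ‖v‖ ^ 2 ≤ ⟪fderiv ℝ (gradient f) x v, v⟫) (q d : E) :
    f q + ⟪gradient f q, d⟫ + m / 2 * ‖d‖ ^ 2 ≤ f (q + d) := by
  have hmono : Monotone (fun t : ℝ => ⟪gradient f (q + t • d), d⟫ - m * t * ‖d‖ ^ 2) := by
    have hder : ∀ t : ℝ, HasDerivAt (fun t : ℝ => ⟪gradient f (q + t • d), d⟫ - m * t * ‖d‖ ^ 2)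
        (⟪fderiv ℝ (gradient f) (q + t • d) d, d⟫ - m * ‖d‖ ^ 2) t := by
      intro t
      refine (cf_line_deriv2 hf q d t).sub ?_
      simpa using ((hasDerivAt_id t).const_mul m).mul_const (‖d‖ ^ 2)
    refine monotone_of_deriv_nonneg (fun t => (hder t).differentiableAt) fun t => ?_
    rw [(hder t).deriv]
    linarith [hm (q + t • d) d]
  have hder : ∀ t : ℝ, HasDerivAt
      (fun t : ℝ => f (q + t • d) - t * ⟪gradient f q, d⟫ - m / 2 * t ^ 2 * ‖d‖ ^ 2)
      (⟪gradient f (q + t • d), d⟫ - ⟪gradient f q, d⟫ - m * t * ‖d‖ ^ 2) t := by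
    intro t
    refine ((cf_line_deriv hf q d t).sub ?_).sub ?_
    · simpa using (hasDerivAt_id t).mul_const (⟪gradient f q, d⟫)
    · have := (((hasDerivAt_id t).pow 2).const_mul (m / 2)).mul_const (‖d‖ ^ 2)
      refine this.congr_deriv ?_
      simp only [id_eq, Nat.cast_ofNat, Nat.add_one_sub_one, pow_one, mul_one]
      ring
  have hm2 : MonotoneOn
      (fun t : ℝ => f (q + t • d) - t * ⟪gradient f q, d⟫ - m / 2 * t ^ 2 * ‖d‖ ^ 2)
      (Set.Ici 0) := by
    refine monotoneOn_of_deriv_nonneg (convex_Ici 0)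
      (fun t _ => (hder t).continuousAt.continuousWithinAt)
      (fun t _ => (hder t).differentiableAt.differentiableWithinAt) fun t ht => ?_
    rw [(hder t).deriv]
    rw [interior_Ici] at ht
    have := hmono (le_of_lt ht)
    simp only [zero_smul, add_zero] at this
    linarith
  have := hm2 (by simp : (0 : ℝ) ∈ Set.Ici 0) (by simp : (1 : ℝ) ∈ Set.Ici 0) zero_le_one
  simp only [zero_smul, add_zero, one_smul] at this
  linarith

theorem cf_gradient_neg (f : E → ℝ) : gradient (fun x => - f x) = fun x => - gradient f x := by
  ext1 x
  simp [gradient]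

theorem cf_taylor_upper {f : E → ℝ} (hf : ContDiff ℝ 2 f) {m : ℝ}
    (hm : ∀ x v, ⟪fderiv ℝ (gradient f) x v, v⟫ ≤ m * ‖v‖ ^ 2) (q d : E) :
    f (q + d) ≤ f q + ⟪gradient f q, d⟫ + m / 2 * ‖d‖ ^ 2 := by
  have := cf_taylor (f := fun x => - f x) (m := -m) hf.neg (fun x v => by
    rw [cf_gradient_neg, fderiv_fun_neg]
    simp only [neg_apply, inner_neg_left]
    linarith [hm x v]) q d
  rw [cf_gradient_neg] at this
  simp only [inner_neg_left] at this
  linarith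

theorem cf_hess_nonneg {f : E → ℝ} (hf : ContDiff ℝ 2 f) (hc : ConvexOn ℝ Set.univ f) (x v : E) :
    0 ≤ ⟪fderiv ℝ (gradient f) x v, v⟫ := by
  have hg : ConvexOn ℝ Set.univ (fun t : ℝ => f (x + t • v)) := by
    have := hc.comp_affineMap (AffineMap.lineMap x (x + v) : ℝ →ᵃ[ℝ] E)
    simp only [Set.preimage_univ] at this
    have he : (fun t : ℝ => f (x + t • v)) = f ∘ (AffineMap.lineMap x (x + v) : ℝ →ᵃ[ℝ] E) := by
      funext t
      simp [AffineMap.lineMap_apply, add_comm]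
    rw [he]
    exact this
  have hm := hg.monotoneOn_deriv (fun t _ => (cf_line_deriv hf x v t).differentiableAt)
  have he : deriv (fun t : ℝ => f (x + t • v)) = fun t : ℝ => ⟪gradient f (x + t • v), v⟫ :=
    funext fun t => (cf_line_deriv hf x v t).deriv
  rw [he, monotoneOn_univ] at hm
  have := hm.deriv_nonneg (x := 0)
  rw [(cf_line_deriv2 hf x v 0).deriv] at this
  simpa using this

theorem cf_grad_inj {f : E → ℝ} (hf : ContDiff ℝ 2 f)
    (hpos : ∀ x v, 0 ≤ ⟪fderiv ℝ (gradient f) x v, v⟫) {x y : E} (hne : x ≠ y)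
    (hxy : gradient f x = gradient f y) : (fderiv ℝ (gradient f) x).det = 0 := by
  set d := y - x with hd
  have hd0 : d ≠ 0 := sub_ne_zero.mpr hne.symm
  have hmono : Monotone (fun t : ℝ => ⟪gradient f (x + t • d), d⟫) := by
    refine monotone_of_deriv_nonneg (fun t => (cf_line_deriv2 hf x d t).differentiableAt) fun t => ?_
    rw [(cf_line_deriv2 hf x d t).deriv]
    exact hpos _ _
  have hconst : ∀ t ∈ Set.Icc (0 : ℝ) 1, ⟪gradient f (x + t • d), d⟫ = ⟪gradient f x, d⟫ := by
    intro t ht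
    have h0 := hmono ht.1
    have h1 := hmono ht.2
    simp only [zero_smul, add_zero, one_smul] at h0 h1
    have : x + d = y := by simp [hd]
    rw [this, ← hxy] at h1
    exact le_antisymm h1 h0
  have hz : ⟪fderiv ℝ (gradient f) x d, d⟫ = 0 := by
    have h1 := (cf_line_deriv2 hf x d 0).hasDerivWithinAt (s := Set.Icc (0 : ℝ) 1)
    have h2 : HasDerivWithinAt (fun t : ℝ => ⟪gradient f (x + t • d), d⟫) 0 (Set.Icc (0 : ℝ) 1) 0 :=
      (hasDerivWithinAt_const (0 : ℝ) (Set.Icc (0 : ℝ) 1) (⟪gradient f x, d⟫)).congr hconst (by simp)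
    have := (uniqueDiffOn_Icc (zero_lt_one (α := ℝ)) 0 (by simp)).eq_deriv _ h1 h2
    simpa using this
  set A := fderiv ℝ (gradient f) x with hA
  have hAd : A d = 0 := by
    by_contra hne0
    have hN : 0 < ‖A d‖ ^ 2 := by positivity
    have key : ∀ t : ℝ, 0 ≤ 2 * t * ‖A d‖ ^ 2 + t ^ 2 * ⟪A (A d), A d⟫ := by
      intro t
      have := hpos x (d + t • A d)
      rw [← hA] at this
      have hs : ⟪A (A d), d⟫ = ⟪A d, A d⟫ := cf_hess_symm hf x (A d) d
      simp only [map_add, map_smul, inner_add_left, inner_add_right, inner_smul_left,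
        inner_smul_right, hz, hs, real_inner_self_eq_norm_sq] at this
      simp at this
      linarith
    have hB : 0 ≤ ⟪A (A d), A d⟫ := hpos x (A d)
    have := key (-(‖A d‖ ^ 2 / (⟪A (A d), A d⟫ + 1)))
    set N := ‖A d‖ ^ 2
    set B := ⟪A (A d), A d⟫
    have h2 : 2 * -(N / (B + 1)) * N + (-(N / (B + 1))) ^ 2 * B = N ^ 2 / (B + 1) ^ 2 * (-2 * (B + 1) + B) := by
      field_simp
    rw [h2] at this
    have h3 : 0 < N ^ 2 / (B + 1) ^ 2 := by positivity
    nlinarith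
  by_contra hdet
  have : (A.toContinuousLinearEquivOfDetNeZero hdet) d = 0 := by simpa using hAd
  exact hd0 ((A.toContinuousLinearEquivOfDetNeZero hdet).map_eq_zero_iff.mp this)

theorem cf_factor {ι : Type*} [Fintype ι] [DecidableEq ι] {K : Matrix ι ι ℝ} (hK : K.PosSemidef) :
    ∃ R : Matrix ι ι ℝ, K = R.conjTranspose * R := by
  open scoped MatrixOrder in
  have := CStarAlgebra.nonneg_iff_eq_star_mul_self.mp hK.nonneg
  exact this

theorem cf_logdet_matrix {ι : Type*} [Fintype ι] [DecidableEq ι] (A B K : Matrix ι ι ℝ)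
    (hA : A.PosSemidef) (hB : B.PosSemidef) (hdA : 0 < A.det) (hdB : 0 < B.det) (hAK : A * K = 1) :
    Real.log B.det - Real.log A.det ≤ (B * K).trace - Fintype.card ι := by
  have hK : K = A⁻¹ := (Matrix.inv_eq_right_inv hAK).symm
  have hKp : K.PosSemidef := hK ▸ hA.inv
  have hdK : A.det * K.det = 1 := by rw [← Matrix.det_mul, hAK, Matrix.det_one]
  obtain ⟨R, hR⟩ := cf_factor hKp
  have hC : (R * B * R.conjTranspose).PosSemidef := hB.mul_mul_conjTranspose_same R
  have htr : (B * K).trace = (R * B * R.conjTranspose).trace := by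
    rw [hR, ← Matrix.mul_assoc, Matrix.trace_mul_comm, ← Matrix.mul_assoc]
  have hdet : (R * B * R.conjTranspose).det = B.det * K.det := by
    rw [hR]; simp only [Matrix.det_mul]; ring
  have hKdpos : 0 < K.det := by
    by_contra h
    nlinarith
  have hpos : 0 < (R * B * R.conjTranspose).det := by rw [hdet]; positivity
  have hlog : Real.log (R * B * R.conjTranspose).det = Real.log B.det - Real.log A.det := by
    rw [hdet, Real.log_mul hdB.ne' hKdpos.ne', eq_inv_of_mul_eq_one_right hdK, Real.log_inv]; ring
  rw [← hlog, htr, hC.1.det_eq_prod_eigenvalues, hC.1.trace_eq_sum_eigenvalues]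
  simp only [RCLike.ofReal_real_eq_id, id]
  have hne : ∀ i, hC.1.eigenvalues i ≠ 0 := by
    intro i h0
    rw [hC.1.det_eq_prod_eigenvalues] at hpos
    simp only [RCLike.ofReal_real_eq_id, id] at hpos
    rw [Finset.prod_eq_zero (Finset.mem_univ i) h0] at hpos
    exact lt_irrefl _ hpos
  rw [Real.log_prod (fun i _ => hne i)]
  have : ∑ i, Real.log (hC.1.eigenvalues i) ≤ ∑ i, (hC.1.eigenvalues i - 1) :=
    Finset.sum_le_sum fun i _ =>
      Real.log_le_sub_one_of_pos (lt_of_le_of_ne (hC.eigenvalues_nonneg i) (hne i).symm)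
  simpa [Finset.sum_sub_distrib] using this

theorem cf_posSemidef (A : E →L[ℝ] E) (hs : ∀ v w, ⟪A v, w⟫ = ⟪v, A w⟫) (hp : ∀ v, 0 ≤ ⟪A v, v⟫) :
    (LinearMap.toMatrix (stdOrthonormalBasis ℝ E).toBasis (stdOrthonormalBasis ℝ E).toBasis
      (A : E →ₗ[ℝ] E)).PosSemidef := by
  rw [LinearMap.posSemidef_toMatrix_iff]
  exact ⟨fun v w => hs v w, fun v => by simpa using hp v⟩

theorem cf_det_nonneg (A : E →L[ℝ] E) (hs : ∀ v w, ⟪A v, w⟫ = ⟪v, A w⟫) (hp : ∀ v, 0 ≤ ⟪A v, v⟫) :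
    0 ≤ A.det := by
  have := (cf_posSemidef A hs hp).det_nonneg
  rwa [LinearMap.det_toMatrix] at this

theorem cf_logdet (A B K : E →L[ℝ] E) (hAs : ∀ v w, ⟪A v, w⟫ = ⟪v, A w⟫) (hAp : ∀ v, 0 ≤ ⟪A v, v⟫)
    (hBs : ∀ v w, ⟪B v, w⟫ = ⟪v, B w⟫) (hBp : ∀ v, 0 ≤ ⟪B v, v⟫)
    (hdA : 0 < A.det) (hdB : 0 < B.det) (hAK : ∀ v, A (K v) = v) :
    Real.log B.det - Real.log A.det ≤
      LinearMap.trace ℝ E ((B.comp K : E →L[ℝ] E) : E →ₗ[ℝ] E) - Module.finrank ℝ E := by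
  set b := (stdOrthonormalBasis ℝ E).toBasis
  have := cf_logdet_matrix (LinearMap.toMatrix b b (A : E →ₗ[ℝ] E))
    (LinearMap.toMatrix b b (B : E →ₗ[ℝ] E)) (LinearMap.toMatrix b b (K : E →ₗ[ℝ] E))
    (cf_posSemidef A hAs hAp) (cf_posSemidef B hBs hBp)
    (by rw [LinearMap.det_toMatrix]; exact hdA) (by rw [LinearMap.det_toMatrix]; exact hdB)
    (by
      rw [← LinearMap.toMatrix_mul]
      have : (A : E →ₗ[ℝ] E) * (K : E →ₗ[ℝ] E) = 1 := by ext v; simp [hAK]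
      rw [this, LinearMap.toMatrix_one])
  rw [LinearMap.det_toMatrix, LinearMap.det_toMatrix, ← LinearMap.toMatrix_mul,
    ← LinearMap.trace_eq_matrix_trace] at this
  rw [Fintype.card_fin] at this
  exact this

variable [MeasurableSpace E] [BorelSpace E]

theorem cf_monge_ampere {G W ψ : E → ℝ} (hGpos : ∀ y, 0 < G y) (hGc : Continuous G)
    (hWc : Continuous W) (hψ : ContDiff ℝ 2 ψ)
    (hpos : ∀ x v, 0 ≤ ⟪fderiv ℝ (gradient ψ) x v, v⟫)
    (hpush : Measure.map (fun y => gradient ψ y)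
      ((volume : Measure E).withDensity fun y => ENNReal.ofReal (G y)) =
      (volume : Measure E).withDensity fun x => ENNReal.ofReal (Real.exp (-W x))) (x : E) :
    G x = (fderiv ℝ (gradient ψ) x).det * Real.exp (-W (gradient ψ x)) := by
  set S := gradient ψ with hS
  have hS1 : ContDiff ℝ 1 S := cf_contDiff_gradient hψ
  have hSc : Continuous S := hS1.continuous
  have hSd : ∀ x, HasFDerivAt S (fderiv ℝ S x) x := fun x =>
    (hS1.differentiable (by norm_num) x).hasFDerivAt
  have hHc : Continuous (fderiv ℝ S) := hS1.continuous_fderiv (by norm_num)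
  have hdetc : Continuous fun x => (fderiv ℝ S x).det := ContinuousLinearMap.continuous_det.comp hHc
  have hdet0 : ∀ x, 0 ≤ (fderiv ℝ S x).det := fun x =>
    cf_det_nonneg _ (cf_hess_symm hψ x) (hpos x)
  set μ := (volume : Measure E).withDensity fun y => ENNReal.ofReal (G y) with hμ
  set ν := (volume : Measure E).withDensity fun x => ENNReal.ofReal (Real.exp (-W x)) with hν
  set Z : Set E := {x | (fderiv ℝ S x).det = 0} with hZ
  have hZm : MeasurableSet Z := (isClosed_eq hdetc continuous_const).measurableSet
  have hSZ : (volume : Measure E) (S '' Z) = 0 :=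
    addHaar_image_eq_zero_of_det_fderivWithin_eq_zero volume
      (fun x _ => (hSd x).hasFDerivWithinAt) (fun x hx => hx)
  have hνSZ : ν (S '' Z) = 0 := withDensity_absolutelyContinuous _ _ hSZ
  have hmapS : ∀ s, μ (S ⁻¹' s) ≤ ν s := by
    intro s
    rw [← hpush]
    exact Measure.le_map_apply hSc.measurable.aemeasurable s
  have hμZ : μ Z = 0 :=
    le_antisymm (((measure_mono (Set.subset_preimage_image S Z)).trans (hmapS _)).trans hνSZ.le) bot_le
  have hinj : Set.InjOn S Zᶜ := by
    intro x hx y _ hxy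
    by_contra hne
    exact hx (cf_grad_inj hψ hpos hne hxy)
  have hae : (fun y => ENNReal.ofReal (G y)) =ᵐ[volume]
      fun y => ENNReal.ofReal ((fderiv ℝ S y).det * Real.exp (-W (S y))) := by
    refine ae_eq_of_forall_setLIntegral_eq_of_sigmaFinite (by fun_prop) ?_ ?_
    · exact (ENNReal.continuous_ofReal.comp
        (hdetc.mul (Real.continuous_exp.comp (hWc.comp hSc).neg))).measurable
    intro s hs _
    have hsm : MeasurableSet (s ∩ Zᶜ) := hs.inter hZm.compl
    have hinj' : Set.InjOn S (s ∩ Zᶜ) := hinj.mono Set.inter_subset_right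
    have him : MeasurableSet (S '' (s ∩ Zᶜ)) :=
      measurable_image_of_fderivWithin hsm (fun x _ => (hSd x).hasFDerivWithinAt) hinj'
    have hpre : S ⁻¹' (S '' (s ∩ Zᶜ)) = s ∩ Zᶜ := by
      refine Set.Subset.antisymm ?_ (Set.subset_preimage_image S _)
      rintro x ⟨y, hy, hyx⟩
      by_cases hne : y = x
      · exact hne ▸ hy
      · exact absurd (cf_grad_inj hψ hpos hne hyx) hy.2
    have e1 : ∫⁻ y in s, ENNReal.ofReal (G y) = μ s := (withDensity_apply _ hs).symm
    have e2 : μ s = μ (s ∩ Zᶜ) := by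
      have := measure_inter_add_sdiff (μ := μ) s hZm
      rw [measure_mono_null Set.inter_subset_right hμZ, zero_add] at this
      rw [← this]; rfl
    have e3 : μ (s ∩ Zᶜ) = ν (S '' (s ∩ Zᶜ)) := by
      rw [← hpush, Measure.map_apply hSc.measurable him]
      exact (congrArg μ hpre).symm
    have e4 : ν (S '' (s ∩ Zᶜ)) =
        ∫⁻ y in s ∩ Zᶜ, ENNReal.ofReal ((fderiv ℝ S y).det * Real.exp (-W (S y))) := by
      rw [hν, withDensity_apply _ him, lintegral_image_eq_lintegral_abs_det_fderiv_mul volume hsm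
        (fun x _ => (hSd x).hasFDerivWithinAt) hinj']
      refine lintegral_congr fun y => ?_
      rw [abs_of_nonneg (hdet0 y), ENNReal.ofReal_mul (hdet0 y)]
    have e5 : ∫⁻ y in s ∩ Zᶜ, ENNReal.ofReal ((fderiv ℝ S y).det * Real.exp (-W (S y))) =
        ∫⁻ y in s, ENNReal.ofReal ((fderiv ℝ S y).det * Real.exp (-W (S y))) := by
      rw [← lintegral_inter_add_sdiff (μ := volume) _ s hZm]
      have : ∫⁻ y in s ∩ Z, ENNReal.ofReal ((fderiv ℝ S y).det * Real.exp (-W (S y))) = 0 := by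
        rw [setLIntegral_congr_fun (g := fun _ => 0) (hs.inter hZm)]
        · simp
        · intro y hy
          have : (fderiv ℝ S y).det = 0 := hy.2
          simp [this]
      rw [this, zero_add]; rfl
    rw [e1, e2, e3, e4, e5]
  have heq := (Continuous.ae_eq_iff_eq (volume : Measure E)
    (ENNReal.continuous_ofReal.comp hGc)
    (ENNReal.continuous_ofReal.comp
        (hdetc.mul (Real.continuous_exp.comp (hWc.comp hSc).neg)))).mp hae
  have := congrFun heq x
  simp only [Function.comp] at this
  exact (ENNReal.ofReal_eq_ofReal_iff (hGpos x).le
    (mul_nonneg (hdet0 x) (Real.exp_pos _).le)).mp this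

theorem cf_dense_range {W : E → ℝ} {S : E → E} (hSc : Continuous S) {μ : Measure E}
    (hWc : Continuous W)
    (hpush : Measure.map S μ =
      (volume : Measure E).withDensity fun x => ENNReal.ofReal (Real.exp (-W x))) :
    DenseRange S := by
  intro y
  rw [mem_closure_iff]
  intro o ho hy
  by_contra hemp
  have hpre : S ⁻¹' o = ∅ := by
    rw [Set.eq_empty_iff_forall_notMem]
    intro x hx
    exact hemp ⟨S x, hx, Set.mem_range_self x⟩
  have h0 : Measure.map S μ o = 0 := by
    rw [Measure.map_apply hSc.measurable ho.measurableSet, hpre, measure_empty]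
  rw [hpush, withDensity_apply_eq_zero (by fun_prop)] at h0
  have : {x | ENNReal.ofReal (Real.exp (-W x)) ≠ 0} ∩ o = o := by
    ext x; simp [Real.exp_pos]
  rw [this] at h0
  exact (ho.measure_pos volume ⟨y, hy⟩).ne' h0

theorem cf_surj {ψ : E → ℝ} (hψ : ContDiff ℝ 2 ψ)
    (hpos : ∀ x v, 0 ≤ ⟪fderiv ℝ (gradient ψ) x v, v⟫) (hd : DenseRange (gradient ψ)) :
    Function.Surjective (gradient ψ) := by
  intro y0
  set g : E → ℝ := fun x => ψ x - ⟪y0, x⟫ with hg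
  have hgc : Continuous g := by
    have := hψ.continuous
    fun_prop
  have hlow : ∀ p x, ψ p + ⟪gradient ψ p, x - p⟫ ≤ ψ x := by
    intro p x
    have := cf_taylor hψ (m := 0) (fun x v => by simpa using hpos x v) p (x - p)
    simpa using this
  -- bounded sublevel set
  have hbdd : ∃ R : ℝ, ∀ x, g x ≤ g 0 → ‖x‖ ≤ R := by
    by_contra hcon
    push Not at hcon
    choose u hu1 hu2 using fun k : ℕ => hcon (k + 1)
    have hupos : ∀ k, 0 < ‖u k‖ := fun k => lt_of_le_of_lt (by positivity) (hu2 k)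
    obtain ⟨e, he, φ, hφ, hlim⟩ := (isCompact_sphere (0 : E) 1).tendsto_subseq
      (x := fun k => ‖u k‖⁻¹ • u k) (fun k => by
        simp [norm_smul, (hupos k).ne'])
    have hen : ‖e‖ = 1 := by simpa using he
    obtain ⟨p, hp⟩ : ∃ p, 0 < ⟪gradient ψ p - y0, e⟫ := by
      have ho : IsOpen {z : E | 0 < ⟪z - y0, e⟫} := isOpen_lt (by fun_prop) (by fun_prop)
      obtain ⟨p, hp⟩ := hd.exists_mem_open ho ⟨y0 + e, by
        simp [hen]⟩
      exact ⟨p, hp⟩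
    set C := ψ p - ⟪gradient ψ p, p⟫ with hC
    have hk : ∀ k, ⟪gradient ψ p - y0, ‖u k‖⁻¹ • u k⟫ ≤ ‖u k‖⁻¹ * (g 0 - C) := by
      intro k
      rw [inner_smul_right]
      refine mul_le_mul_of_nonneg_left ?_ (by positivity)
      have h1 := hlow p (u k)
      have h2 := hu1 k
      simp only [hg, inner_sub_right, inner_sub_left, hC] at h1 h2 ⊢
      linarith
    have hlim1 : Filter.Tendsto (fun k => ⟪gradient ψ p - y0, ‖u (φ k)‖⁻¹ • u (φ k)⟫) Filter.atTop
        (nhds ⟪gradient ψ p - y0, e⟫) :=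
      ((continuous_const.inner continuous_id).tendsto e).comp hlim
    have hun : Filter.Tendsto (fun k => ‖u k‖) Filter.atTop Filter.atTop :=
      Filter.tendsto_atTop_mono (fun k => by linarith [hu2 k]) tendsto_natCast_atTop_atTop
    have hlim2 : Filter.Tendsto (fun k => ‖u (φ k)‖⁻¹ * (g 0 - C)) Filter.atTop (nhds 0) := by
      have := ((tendsto_inv_atTop_zero.comp hun).comp hφ.tendsto_atTop).mul_const (g 0 - C)
      simpa using this
    have := le_of_tendsto_of_tendsto' hlim1 hlim2 (fun k => hk (φ k))
    linarith
  obtain ⟨R, hR⟩ := hbdd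
  obtain ⟨x, hx⟩ : ∃ x, ∀ z, g x ≤ g z := by
    refine hgc.exists_forall_le' 0 ?_
    have h1 : (Metric.closedBall (0 : E) R)ᶜ ∈ Filter.cocompact E :=
      (isCompact_closedBall (0 : E) R).compl_mem_cocompact
    filter_upwards [h1] with z hz
    by_contra hlt
    exact hz (by simpa using hR z (not_le.mp hlt).le)
  refine ⟨x, ?_⟩
  have hmin : IsLocalMin g x := Filter.Eventually.of_forall hx
  have hder : HasFDerivAt g (fderiv ℝ ψ x - innerSL ℝ y0) x :=
    (hψ.differentiable (by norm_num) x).hasFDerivAt.sub (innerSL ℝ y0).hasFDerivAt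
  have h0 := hmin.hasFDerivAt_eq_zero hder
  refine ext_inner_right ℝ fun v => ?_
  rw [inner_gradient_left]
  have := congrArg (fun L => L v) h0
  simp at this
  linarith

theorem cf_diffeo {ψ : E → ℝ} (hψ : ContDiff ℝ 2 ψ)
    (hpos : ∀ x v, 0 ≤ ⟪fderiv ℝ (gradient ψ) x v, v⟫)
    (hdet : ∀ x, (fderiv ℝ (gradient ψ) x).det ≠ 0)
    (hsurj : Function.Surjective (gradient ψ)) :
    ∃ Φ : E → E, ContDiff ℝ 1 Φ ∧ (∀ y, gradient ψ (Φ y) = y) ∧ (∀ x, Φ (gradient ψ x) = x) := by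
  have hS1 := cf_contDiff_gradient hψ
  have hinj : Function.Injective (gradient ψ) := by
    intro x y hxy
    by_contra hne
    exact hdet x (cf_grad_inj hψ hpos hne hxy)
  have hopen : IsOpenMap (gradient ψ) := by
    refine isOpenMap_of_hasStrictFDerivAt_equiv
      (f' := fun x => (fderiv ℝ (gradient ψ) x).toContinuousLinearEquivOfDetNeZero (hdet x)) ?_
    intro x
    rw [ContinuousLinearMap.coe_toContinuousLinearEquivOfDetNeZero]
    exact hS1.contDiffAt.hasStrictFDerivAt (by norm_num)
  let e := (Equiv.ofBijective _ ⟨hinj, hsurj⟩).toHomeomorphOfContinuousOpen hS1.continuous hopen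
  refine ⟨e.symm, ?_, fun y => e.apply_symm_apply y, fun x => e.symm_apply_apply x⟩
  refine e.contDiff_symm
    (f₀' := fun x => (fderiv ℝ (gradient ψ) x).toContinuousLinearEquivOfDetNeZero (hdet x)) ?_ hS1
  intro x
  rw [ContinuousLinearMap.coe_toContinuousLinearEquivOfDetNeZero]
  exact (hS1.differentiable (by norm_num) x).hasFDerivAt

theorem cf_div {X : E → E} (hX : ContDiff ℝ 1 X) (hc : HasCompactSupport X) :
    Integrable (fun y => LinearMap.trace ℝ E (fderiv ℝ X y : E →ₗ[ℝ] E)) ∧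
    ∫ y, LinearMap.trace ℝ E (fderiv ℝ X y : E →ₗ[ℝ] E) = 0 := by
  set b := stdOrthonormalBasis ℝ E
  have hder : ∀ i y, HasFDerivAt (fun y => ⟪b i, X y⟫) ((innerSL ℝ (b i)).comp (fderiv ℝ X y)) y :=
    fun i y => (innerSL ℝ (b i)).hasFDerivAt.comp y
      (hX.differentiable (by norm_num) y).hasFDerivAt
  have hdc : Continuous (fderiv ℝ X) := hX.continuous_fderiv (by norm_num)
  have hint : ∀ i, Integrable (fun y => ⟪b i, fderiv ℝ X y (b i)⟫) := by
    intro i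
    refine Continuous.integrable_of_hasCompactSupport (by fun_prop) ?_
    exact (hc.fderiv (𝕜 := ℝ)).comp_left (g := fun L : E →L[ℝ] E => ⟪b i, L (b i)⟫) (by simp)
  have hint0 : ∀ i, Integrable (fun y => ⟪b i, X y⟫) := by
    intro i
    have := hX.continuous
    refine Continuous.integrable_of_hasCompactSupport (by fun_prop) ?_
    exact hc.comp_left (g := fun L : E => ⟪b i, L⟫) (by simp)
  have hz : ∀ i, ∫ y, ⟪b i, fderiv ℝ X y (b i)⟫ = 0 := by
    intro i
    have he : ∀ y, fderiv ℝ (fun y => ⟪b i, X y⟫) y (b i) = ⟪b i, fderiv ℝ X y (b i)⟫ := by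
      intro y
      rw [(hder i y).fderiv]; simp
    have := integral_mul_fderiv_eq_neg_fderiv_mul_of_integrable (μ := (volume : Measure E))
      (f := fun _ : E => (1 : ℝ)) (g := fun y => ⟪b i, X y⟫) (v := b i)
      (by simp) (by simpa only [he, one_mul] using hint i) (by simpa using hint0 i)
      (fun x _ => by fun_prop) (fun x _ => (hder i x).differentiableAt)
    simpa [he] using this
  have htr : (fun y => LinearMap.trace ℝ E (fderiv ℝ X y : E →ₗ[ℝ] E)) =
      fun y => ∑ i, ⟪b i, fderiv ℝ X y (b i)⟫ := by
    funext y
    rw [LinearMap.trace_eq_sum_inner _ b]; rfl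
  rw [htr]
  refine ⟨integrable_finsetSum _ fun i _ => hint i, ?_⟩
  rw [integral_finsetSum _ fun i _ => hint i]
  exact Finset.sum_eq_zero fun i _ => hz i

theorem cf_trace_smul {g : E → ℝ} {Y : E → E} {g' : E →L[ℝ] ℝ} {Y' : E →L[ℝ] E} {y : E}
    (hg : HasFDerivAt g g' y) (hY : HasFDerivAt Y Y' y) :
    LinearMap.trace ℝ E (fderiv ℝ (fun y => g y • Y y) y : E →ₗ[ℝ] E) =
      g y * LinearMap.trace ℝ E (Y' : E →ₗ[ℝ] E) + g' (Y y) := by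
  rw [(hg.fun_smul hY).fderiv]
  rw [ContinuousLinearMap.toLinearMap_add, ContinuousLinearMap.toLinearMap_smul, map_add, map_smul,
    ContinuousLinearMap.coe_smulRight, LinearMap.trace_smulRight]
  rfl

/-- pointwise lower bound of the divergence of the test field -/
theorem cf_trace_bound {W F θ : E → ℝ} {Φ : E → E} (hW : ContDiff ℝ 2 W)
    (hF : ContDiff ℝ 2 F) (hΦ : ContDiff ℝ 1 Φ) (hθ : ContDiff ℝ 1 θ)
    {c δ q0 : ℝ} {q : E → ℝ} (hδ : 0 < δ)
    (hK : ∀ y v, 0 ≤ ⟪fderiv ℝ Φ y v, v⟫)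
    (h1 : ∀ y, c < F (Φ y) → δ * q y ≤ LinearMap.trace ℝ E
      (((fderiv ℝ (gradient F) (Φ y)).comp (fderiv ℝ Φ y) : E →L[ℝ] E) : E →ₗ[ℝ] E)
        - ⟪gradient W y, gradient F (Φ y)⟫)
    (h2 : ∀ y, c < F (Φ y) → q0 ≤ q y)
    (h3 : ∀ y, ‖gradient F (Φ y)‖ ^ 2 ≤ 2 * q y) (y : E) :
    Real.exp (-W y) * Real.smoothTransition (F (Φ y) - c) *
      (δ / 2 * q0 * θ y ^ 2 - 4 / δ * ‖fderiv ℝ θ y‖ ^ 2) ≤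
    LinearMap.trace ℝ E (fderiv ℝ (fun y =>
      (Real.exp (-W y) * (Real.smoothTransition (F (Φ y) - c) * θ y ^ 2)) • gradient F (Φ y)) y
        : E →ₗ[ℝ] E) := by
  set ξ := gradient F (Φ y) with hξ
  set K := fderiv ℝ Φ y with hKdef
  have dW : HasFDerivAt W (fderiv ℝ W y) y := (hW.differentiable (by norm_num) y).hasFDerivAt
  have dΦ : HasFDerivAt Φ K y := (hΦ.differentiable (by norm_num) y).hasFDerivAt
  have dF : HasFDerivAt F (fderiv ℝ F (Φ y)) (Φ y) :=
    (hF.differentiable (by norm_num) _).hasFDerivAt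
  have dG : HasFDerivAt (gradient F) (fderiv ℝ (gradient F) (Φ y)) (Φ y) :=
    ((cf_contDiff_gradient hF).differentiable (by norm_num) _).hasFDerivAt
  have dθ : HasFDerivAt θ (fderiv ℝ θ y) y := (hθ.differentiable (by norm_num) y).hasFDerivAt
  have dη : HasDerivAt Real.smoothTransition (deriv Real.smoothTransition (F (Φ y) - c))
      (F (Φ y) - c) :=
    ((Real.smoothTransition.contDiff (n := 1)).differentiable (by norm_num) _).hasDerivAt
  have hη' : 0 ≤ deriv Real.smoothTransition (F (Φ y) - c) :=
    Real.smoothTransition.monotone.deriv_nonneg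
  set η' := deriv Real.smoothTransition (F (Φ y) - c)
  set η := Real.smoothTransition (F (Φ y) - c) with hηdef
  have d1 : HasFDerivAt (fun y => Real.smoothTransition (F (Φ y) - c))
      (η' • (fderiv ℝ F (Φ y)).comp K) y := by
    have d0 : HasFDerivAt (fun y => F (Φ y) - c) ((fderiv ℝ F (Φ y)).comp K) y :=
      (dF.comp y dΦ).sub_const c
    exact dη.comp_hasFDerivAt y d0
  obtain ⟨g', hg', hval⟩ : ∃ g' : E →L[ℝ] ℝ, HasFDerivAt (fun y =>
      Real.exp (-W y) * (Real.smoothTransition (F (Φ y) - c) * θ y ^ 2)) g' y ∧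
      ∀ v, g' v = Real.exp (-W y) * (η * (2 * θ y * fderiv ℝ θ y v) +
        θ y ^ 2 * (η' * fderiv ℝ F (Φ y) (K v))) - η * θ y ^ 2 * Real.exp (-W y) * fderiv ℝ W y v := by
    have dθ2 : HasFDerivAt (fun y => θ y ^ 2) ((2 * θ y) • fderiv ℝ θ y) y := by
      refine (dθ.pow 2).congr_fderiv ?_
      ext v
      simp
    refine ⟨_, (dW.fun_neg.exp).fun_mul (d1.fun_mul dθ2), fun v => ?_⟩
    simp [← hηdef]
    ring
  have dGΦ : HasFDerivAt (fun y => gradient F (Φ y)) ((fderiv ℝ (gradient F) (Φ y)).comp K) y :=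
    dG.comp y dΦ
  rw [cf_trace_smul hg' dGΦ, hval]
  have hDW : fderiv ℝ W y ξ = ⟪gradient W y, ξ⟫ := inner_gradient_left.symm
  have hDF : fderiv ℝ F (Φ y) (K ξ) = ⟪K ξ, ξ⟫ := by
    rw [← inner_gradient_left, real_inner_comm]
  have hKξ := hK y ξ
  have hθξ : |fderiv ℝ θ y ξ| ≤ ‖fderiv ℝ θ y‖ * ‖ξ‖ := by
    simpa using (fderiv ℝ θ y).le_opNorm ξ
  simp only [← hξ, ← hηdef]
  rw [hDW, hDF]
  set tr := LinearMap.trace ℝ E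
      (((fderiv ℝ (gradient F) (Φ y)).comp K : E →L[ℝ] E) : E →ₗ[ℝ] E) with htr
  have hexp := Real.exp_pos (-W y)
  set ex := Real.exp (-W y)
  set Q := ⟪K ξ, ξ⟫
  set w := ⟪gradient W y, ξ⟫
  have hη0 : 0 ≤ η := Real.smoothTransition.nonneg _
  have hrest : η * (δ / 2 * q0 * θ y ^ 2 - 4 / δ * ‖fderiv ℝ θ y‖ ^ 2) ≤
      η * (θ y ^ 2 * (tr - w) + 2 * θ y * fderiv ℝ θ y ξ) := by
    by_cases hc : c < F (Φ y)
    · refine mul_le_mul_of_nonneg_left ?_ hη0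
      have e1 : δ * q y ≤ tr - w := h1 y hc
      have e2 := h2 y hc
      have e3 : ‖ξ‖ ^ 2 ≤ 2 * q y := h3 y
      set N := ‖fderiv ℝ θ y‖
      have hN : 0 ≤ N := norm_nonneg _
      have e4 : - (|θ y| * (N * ‖ξ‖)) ≤ θ y * fderiv ℝ θ y ξ := by
        have : |θ y * fderiv ℝ θ y ξ| ≤ |θ y| * (N * ‖ξ‖) := by
          rw [abs_mul]; exact mul_le_mul_of_nonneg_left hθξ (abs_nonneg _)
        exact (abs_le.mp this).1
      have e5 : 2 * (|θ y| * (N * ‖ξ‖)) ≤ δ / 4 * (θ y ^ 2 * ‖ξ‖ ^ 2) + 4 / δ * N ^ 2 := by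
        have hsq : 0 ≤ δ / 4 * (|θ y| * ‖ξ‖ - 4 / δ * N) ^ 2 := by positivity
        have : δ / 4 * (|θ y| * ‖ξ‖ - 4 / δ * N) ^ 2 = δ / 4 * (|θ y| ^ 2 * ‖ξ‖ ^ 2) -
            2 * (|θ y| * (N * ‖ξ‖)) + 4 / δ * N ^ 2 := by
          field_simp
          ring
        rw [this, sq_abs] at hsq
        linarith
      have hθ2 : 0 ≤ θ y ^ 2 := sq_nonneg _
      have e6 : θ y ^ 2 * (δ * q y) ≤ θ y ^ 2 * (tr - w) := mul_le_mul_of_nonneg_left e1 hθ2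
      have e7 : δ / 4 * (θ y ^ 2 * ‖ξ‖ ^ 2) ≤ δ / 4 * (θ y ^ 2 * (2 * q y)) := by gcongr
      have e8 : δ / 2 * θ y ^ 2 * q0 ≤ δ / 2 * θ y ^ 2 * q y := by gcongr
      linarith
    · have : η = 0 := Real.smoothTransition.zero_of_nonpos (by linarith)
      simp [this]
  have h5 : 0 ≤ ex * (θ y ^ 2 * (η' * Q)) := by positivity
  have h6 := mul_le_mul_of_nonneg_left hrest hexp.le
  nlinarith [h5, h6]

theorem cf_maxprinciple {W F : E → ℝ} {Φ : E → E} (hW : ContDiff ℝ 2 W)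
    (hint : Integrable fun y => Real.exp (-W y))
    (hF : ContDiff ℝ 2 F) (hΦ : ContDiff ℝ 1 Φ)
    {c δ q0 : ℝ} {q : E → ℝ} (hδ : 0 < δ) (hq0 : 0 < q0)
    (hK : ∀ y v, 0 ≤ ⟪fderiv ℝ Φ y v, v⟫)
    (h1 : ∀ y, c < F (Φ y) → δ * q y ≤ LinearMap.trace ℝ E
      (((fderiv ℝ (gradient F) (Φ y)).comp (fderiv ℝ Φ y) : E →L[ℝ] E) : E →ₗ[ℝ] E)
        - ⟪gradient W y, gradient F (Φ y)⟫)
    (h2 : ∀ y, c < F (Φ y) → q0 ≤ q y)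
    (h3 : ∀ y, ‖gradient F (Φ y)‖ ^ 2 ≤ 2 * q y) (y0 : E) : F (Φ y0) ≤ c := by
  by_contra hcon
  push Not at hcon
  set u : E → ℝ := fun y => Real.exp (-W y) * Real.smoothTransition (F (Φ y) - c) with hu
  have hΦc := hΦ.continuous
  have hFc := hF.continuous
  have hWc := hW.continuous
  have huc : Continuous u :=
    (Real.continuous_exp.comp hWc.neg).mul
      (Real.smoothTransition.continuous.comp ((hFc.comp hΦc).sub continuous_const))
  have hu0 : ∀ y, 0 ≤ u y := fun y =>
    mul_nonneg (Real.exp_pos _).le (Real.smoothTransition.nonneg _)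
  have hule : ∀ y, u y ≤ Real.exp (-W y) := fun y =>
    mul_le_of_le_one_right (Real.exp_pos _).le (Real.smoothTransition.le_one _)
  have huint : Integrable u := hint.mono' huc.aestronglyMeasurable
    (Filter.Eventually.of_forall fun y => by
      rw [Real.norm_of_nonneg (hu0 y)]; exact hule y)
  let β : ContDiffBump (0 : E) := ⟨1, 2, by norm_num, by norm_num⟩
  have hβ1 : ContDiff ℝ 1 β := β.contDiff
  obtain ⟨C, hC⟩ := (hβ1.continuous_fderiv (by norm_num)).bounded_above_of_compact_support
    (β.hasCompactSupport.fderiv (𝕜 := ℝ))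
  have hC0 : 0 ≤ C := (norm_nonneg _).trans (hC 0)
  set I := ∫ y, Real.exp (-W y) with hI
  have hI0 : 0 ≤ I := integral_nonneg fun y => (Real.exp_pos _).le
  set R0 := ‖y0‖ + 1 with hR0
  set m := ∫ y in Metric.ball (0 : E) R0, u y with hm
  have hmpos : 0 < m := by
    rw [hm, setIntegral_pos_iff_support_of_nonneg_ae
      (Filter.Eventually.of_forall hu0) huint.integrableOn]
    refine (huc.isOpen_support.inter Metric.isOpen_ball).measure_pos volume ⟨y0, ?_, ?_⟩
    · exact (mul_pos (Real.exp_pos _) (Real.smoothTransition.pos_of_pos (by linarith))).ne'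
    · simp [hR0]
  have key : ∀ R : ℝ, R0 ≤ R → δ / 2 * q0 * m ≤ 4 / δ * C ^ 2 * I * (R⁻¹) ^ 2 := by
    intro R hR
    have hRpos : 0 < R := lt_of_lt_of_le (by positivity) hR
    set θ : E → ℝ := fun y => β (R⁻¹ • y) with hθ
    have hθ1 : ContDiff ℝ 1 θ := hβ1.comp (contDiff_const_smul R⁻¹)
    have hθd : ∀ y, ‖fderiv ℝ θ y‖ ≤ R⁻¹ * C := by
      intro y
      have hd : HasFDerivAt θ ((fderiv ℝ β (R⁻¹ • y)).comp (R⁻¹ • ContinuousLinearMap.id ℝ E)) y :=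
        (hβ1.differentiable (by norm_num) _).hasFDerivAt.comp y
          ((hasFDerivAt_id y).const_smul R⁻¹)
      rw [hd.fderiv, ContinuousLinearMap.comp_smul, ContinuousLinearMap.comp_id, norm_smul,
        Real.norm_of_nonneg (by positivity)]
      exact mul_le_mul_of_nonneg_left (hC _) (by positivity)
    have hθcs : HasCompactSupport θ := β.hasCompactSupport.comp_smul (inv_ne_zero hRpos.ne')
    set X : E → E := fun y =>
      (Real.exp (-W y) * (Real.smoothTransition (F (Φ y) - c) * θ y ^ 2)) • gradient F (Φ y) with hX
    have hX1 : ContDiff ℝ 1 X := by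
      have a1 : ContDiff ℝ 1 (fun y => gradient F (Φ y)) := (cf_contDiff_gradient hF).comp hΦ
      have a2 : ContDiff ℝ 1 (fun y => Real.smoothTransition (F (Φ y) - c)) :=
        (Real.smoothTransition.contDiff (n := 1)).comp
          (((hF.of_le (by norm_num)).comp hΦ).sub contDiff_const)
      have a3 : ContDiff ℝ 1 (fun y => Real.exp (-W y)) :=
        (hW.of_le (by norm_num)).neg.exp
      exact (a3.mul (a2.mul (hθ1.pow 2))).smul a1
    have hXcs : HasCompactSupport X := by
      refine hθcs.mono fun y hy => ?_
      rw [Function.mem_support] at hy ⊢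
      intro h0
      exact hy (by simp [hX, h0])
    obtain ⟨hti, ht0⟩ := cf_div hX1 hXcs
    have hpt : ∀ y, δ / 2 * q0 * (u y * θ y ^ 2) - 4 / δ * C ^ 2 * (R⁻¹) ^ 2 * Real.exp (-W y) ≤
        LinearMap.trace ℝ E (fderiv ℝ X y : E →ₗ[ℝ] E) := by
      intro y
      refine le_trans ?_ (cf_trace_bound hW hF hΦ hθ1 hδ hK h1 h2 h3 y)
      have e1 : ‖fderiv ℝ θ y‖ ^ 2 ≤ (R⁻¹ * C) ^ 2 := by
        gcongr; exact hθd y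
      have e2 : u y * ‖fderiv ℝ θ y‖ ^ 2 ≤ Real.exp (-W y) * (R⁻¹ * C) ^ 2 :=
        mul_le_mul (hule y) e1 (by positivity) (Real.exp_pos _).le
      have e3 := mul_le_mul_of_nonneg_left e2 (by positivity : 0 ≤ 4 / δ)
      change _ ≤ u y * _
      nlinarith [e3]
    have huθ : Integrable (fun y => u y * θ y ^ 2) := by
      refine huint.mono' (huc.mul (hθ1.continuous.pow 2)).aestronglyMeasurable
        (Filter.Eventually.of_forall fun y => ?_)
      rw [Real.norm_of_nonneg (mul_nonneg (hu0 y) (sq_nonneg _))]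
      exact mul_le_of_le_one_right (hu0 y) (pow_le_one₀ β.nonneg β.le_one)
    have hle := integral_mono ((huθ.const_mul (δ / 2 * q0)).sub
      (hint.const_mul (4 / δ * C ^ 2 * (R⁻¹) ^ 2))) hti hpt
    simp only [Pi.sub_apply] at hle
    rw [ht0, integral_sub (huθ.const_mul _) (hint.const_mul _), integral_const_mul,
      integral_const_mul] at hle
    have hmle : m ≤ ∫ y, u y * θ y ^ 2 := by
      have e1 : m = ∫ y in Metric.ball (0 : E) R0, u y * θ y ^ 2 := by
        refine setIntegral_congr_fun Metric.isOpen_ball.measurableSet fun y hy => ?_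
        have : θ y = 1 := by
          refine β.one_of_mem_closedBall ?_
          have hy' : ‖y‖ < R0 := by simpa using hy
          have : ‖R⁻¹ • y‖ ≤ 1 := by
            rw [norm_smul, Real.norm_of_nonneg (by positivity), inv_mul_le_iff₀ hRpos]
            linarith
          simpa using this
        simp [this]
      rw [e1]
      exact setIntegral_le_integral huθ
        (Filter.Eventually.of_forall fun y => mul_nonneg (hu0 y) (sq_nonneg _))
    have := mul_le_mul_of_nonneg_left hmle (by positivity : 0 ≤ δ / 2 * q0)
    linarith
  have hlim : Filter.Tendsto (fun R : ℝ => 4 / δ * C ^ 2 * I * (R⁻¹) ^ 2) Filter.atTop (nhds 0) := by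
    have := (tendsto_inv_atTop_zero (𝕜 := ℝ)).pow 2 |>.const_mul (4 / δ * C ^ 2 * I)
    simpa using this
  have := ge_of_tendsto hlim ((Filter.eventually_ge_atTop R0).mono key)
  have : 0 < δ / 2 * q0 * m := by positivity
  linarith

theorem cf_second_diff {ψ : E → ℝ} (hψ : ContDiff ℝ 2 ψ) {m : ℝ}
    (hm : ∀ x h, ψ (x + h) + ψ (x + -h) - 2 * ψ x ≤ m * ‖h‖ ^ 2) (x v : E) :
    ⟪fderiv ℝ (gradient ψ) x v, v⟫ ≤ m * ‖v‖ ^ 2 := by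
  by_contra hcon
  push Not at hcon
  set f : ℝ → ℝ := fun t => ψ (x + t • v) + ψ (x + t • (-v)) - m * ‖v‖ ^ 2 * t ^ 2 with hf
  have hf1 : ∀ t, HasDerivAt f (⟪gradient ψ (x + t • v), v⟫ + ⟪gradient ψ (x + t • (-v)), -v⟫
      - m * ‖v‖ ^ 2 * (2 * t)) t := by
    intro t
    refine ((cf_line_deriv hψ x v t).add (cf_line_deriv hψ x (-v) t)).sub ?_
    simpa using (hasDerivAt_pow 2 t).const_mul (m * ‖v‖ ^ 2)
  have hdf : deriv f = fun t => ⟪gradient ψ (x + t • v), v⟫ + ⟪gradient ψ (x + t • (-v)), -v⟫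
      - m * ‖v‖ ^ 2 * (2 * t) := funext fun t => (hf1 t).deriv
  have hf2 : HasDerivAt (deriv f) (⟪fderiv ℝ (gradient ψ) x v, v⟫ +
      ⟪fderiv ℝ (gradient ψ) x (-v), -v⟫ - m * ‖v‖ ^ 2 * 2) 0 := by
    rw [hdf]
    have e1 := cf_line_deriv2 hψ x v 0
    have e2 := cf_line_deriv2 hψ x (-v) 0
    simp only [zero_smul, add_zero] at e1 e2
    refine (e1.add e2).sub ?_
    simpa using ((hasDerivAt_id (0 : ℝ)).const_mul 2).const_mul (m * ‖v‖ ^ 2)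
  have hdd : deriv (deriv f) 0 = 2 * (⟪fderiv ℝ (gradient ψ) x v, v⟫ - m * ‖v‖ ^ 2) := by
    rw [hf2.deriv]
    simp only [map_neg, inner_neg_left, inner_neg_right, neg_neg]
    ring
  have hddpos : 0 < deriv (deriv f) 0 := by rw [hdd]; linarith
  have hd0 : deriv f 0 = 0 := by
    rw [hdf]; simp
  have hmin : IsLocalMin f 0 :=
    isLocalMin_of_deriv_deriv_pos hddpos hd0 (hf1 0).continuousAt
  have hmax : ∀ t, f t ≤ f 0 := by
    intro t
    have := hm x (t • v)
    rw [norm_smul, mul_pow, Real.norm_eq_abs, sq_abs] at this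
    simp only [hf, smul_neg, zero_smul, add_zero, neg_zero]
    nlinarith
  have heq : f =ᶠ[nhds 0] fun _ => f 0 := by
    filter_upwards [hmin] with t ht
    exact le_antisymm (hmax t) ht
  have h2 : deriv (deriv f) 0 = 0 := by
    have h3 := heq.deriv.deriv_eq
    rw [h3]
    simp
  linarith

theorem cf_cocoercive {ψ : E → ℝ} (hψ : ContDiff ℝ 2 ψ)
    (hpos : ∀ x v, 0 ≤ ⟪fderiv ℝ (gradient ψ) x v, v⟫) {m : ℝ} (hm : 0 < m)
    (hup : ∀ x v, ⟪fderiv ℝ (gradient ψ) x v, v⟫ ≤ m * ‖v‖ ^ 2) (x d : E) :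
    ψ (x + d) - ψ x - ⟪gradient ψ x, d⟫ ≤ ‖gradient ψ (x + d) - gradient ψ x‖ * ‖d‖ -
      m⁻¹ / 2 * ‖gradient ψ (x + d) - gradient ψ x‖ ^ 2 := by
  set a := gradient ψ (x + d) - gradient ψ x with ha
  have h1 := cf_taylor_upper hψ hup x (m⁻¹ • a)
  have h2 := cf_taylor hψ (m := 0) (fun x v => by simpa using hpos x v) (x + d) (m⁻¹ • a - d)
  have e : x + d + (m⁻¹ • a - d) = x + m⁻¹ • a := by abel
  rw [e] at h2
  have hS : gradient ψ (x + d) = a + gradient ψ x := by simp [ha]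
  rw [hS] at h2
  simp only [inner_add_left, inner_sub_right, inner_smul_right, norm_smul, real_inner_self_eq_norm_sq,
    Real.norm_of_nonneg (inv_pos.mpr hm).le, mul_pow] at h1 h2
  have h3 := real_inner_le_norm a d
  have h4 : m / 2 * ((m⁻¹) ^ 2 * ‖a‖ ^ 2) = m⁻¹ / 2 * ‖a‖ ^ 2 := by
    field_simp
  rw [h4] at h1
  linarith

theorem cf_cocoercive0 {ψ : E → ℝ} (hψ : ContDiff ℝ 2 ψ)
    (hpos : ∀ x v, 0 ≤ ⟪fderiv ℝ (gradient ψ) x v, v⟫) (x d : E) :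
    ψ (x + d) - ψ x - ⟪gradient ψ x, d⟫ ≤ ‖gradient ψ (x + d) - gradient ψ x‖ * ‖d‖ -
      0 / 2 * ‖gradient ψ (x + d) - gradient ψ x‖ ^ 2 := by
  have h2 := cf_taylor hψ (m := 0) (fun x v => by simpa using hpos x v) (x + d) (-d)
  have e : x + d + -d = x := by abel
  rw [e] at h2
  have h3 := real_inner_le_norm (gradient ψ (x + d) - gradient ψ x) d
  simp only [inner_neg_right, inner_sub_left] at h2 h3
  linarith

theorem cf_step {g W ψ : E → ℝ} {Φ : E → E} (hg : ContDiff ℝ 2 g) (hW : ContDiff ℝ 2 W)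
    (hψ : ContDiff ℝ 2 ψ) (hint : Integrable fun y => Real.exp (-W y)) {A κ : ℝ}
    (hghess : ∀ y v, -A * ‖v‖ ^ 2 ≤ ⟪fderiv ℝ (gradient g) y v, v⟫)
    (hWhess : ∀ x v, κ * ‖v‖ ^ 2 ≤ ⟪fderiv ℝ (gradient W) x v, v⟫)
    (hpos : ∀ x v, 0 ≤ ⟪fderiv ℝ (gradient ψ) x v, v⟫)
    (hdet : ∀ x, 0 < (fderiv ℝ (gradient ψ) x).det)
    (hMA : ∀ x, g x = Real.log (fderiv ℝ (gradient ψ) x).det - W (gradient ψ x))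
    (hΦ : ContDiff ℝ 1 Φ) (hΦr : ∀ y, gradient ψ (Φ y) = y) (hΦl : ∀ x, Φ (gradient ψ x) = x)
    {τ r : ℝ} (hA : 0 < A) (hτ : 0 ≤ τ) (hr : 0 < r) (hrA : A < κ * r ^ 2) (hτr : τ * r ≤ 1)
    (hco : ∀ x d, ψ (x + d) - ψ x - ⟪gradient ψ x, d⟫ ≤ ‖gradient ψ (x + d) - gradient ψ x‖ * ‖d‖ -
      τ / 2 * ‖gradient ψ (x + d) - gradient ψ x‖ ^ 2) (x h : E) :
    ψ (x + h) + ψ (x + -h) - 2 * ψ x ≤ (2 * r - τ * r ^ 2) * ‖h‖ ^ 2 := by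
  by_cases hh : h = 0
  · subst hh
    simp
    linarith
  have hN : 0 < ‖h‖ := norm_pos_iff.mpr hh
  have hS1 := cf_contDiff_gradient hψ
  set S := gradient ψ with hS
  have dS : ∀ x, HasFDerivAt S (fderiv ℝ S x) x := fun x =>
    (hS1.differentiable (by norm_num) x).hasFDerivAt
  have dψ : ∀ x, HasFDerivAt ψ (fderiv ℝ ψ x) x := fun x =>
    (hψ.differentiable (by norm_num) x).hasFDerivAt
  set F : E → ℝ := fun x => ψ (x + h) + ψ (x + -h) - 2 * ψ x with hF
  have hF2 : ContDiff ℝ 2 F :=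
    ((hψ.comp (contDiff_id.add contDiff_const)).add
      (hψ.comp (contDiff_id.add contDiff_const))).sub (contDiff_const.mul hψ)
  have hgF : gradient F = fun x => S (x + h) + S (x + -h) - (2 : ℝ) • S x := by
    funext x
    have hd : HasFDerivAt F (fderiv ℝ ψ (x + h) + fderiv ℝ ψ (x + -h) - (2 : ℝ) • fderiv ℝ ψ x) x :=
      (((hasFDerivAt_comp_add_right h).2 (dψ (x + h))).add ((hasFDerivAt_comp_add_right (-h)).2 (dψ (x + -h)))).sub
        ((dψ x).const_mul 2)
    refine ext_inner_right ℝ fun v => ?_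
    rw [inner_gradient_left, hd.fderiv]
    simp only [hS, inner_sub_left, inner_add_left, inner_smul_left, inner_gradient_left]
    simp
  have hHF : ∀ x, fderiv ℝ (gradient F) x =
      fderiv ℝ S (x + h) + fderiv ℝ S (x + -h) - (2 : ℝ) • fderiv ℝ S x := by
    intro x
    rw [hgF]
    exact ((((hasFDerivAt_comp_add_right h).2 (dS (x + h))).add ((hasFDerivAt_comp_add_right (-h)).2 (dS (x + -h)))).sub
        ((dS x).const_smul (2 : ℝ))).fderiv
  have hHK : ∀ y v, fderiv ℝ S (Φ y) (fderiv ℝ Φ y v) = v := by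
    intro y v
    have h1 : HasFDerivAt (fun y => S (Φ y)) ((fderiv ℝ S (Φ y)).comp (fderiv ℝ Φ y)) y :=
      (dS (Φ y)).comp y (hΦ.differentiable (by norm_num) y).hasFDerivAt
    have h2 : HasFDerivAt (fun y => S (Φ y)) (ContinuousLinearMap.id ℝ E) y := by
      have : (fun y => S (Φ y)) = id := funext hΦr
      rw [this]; exact hasFDerivAt_id y
    have := congrArg (fun L => L v) (h1.unique h2)
    simpa using this
  have hK : ∀ y v, 0 ≤ ⟪fderiv ℝ Φ y v, v⟫ := by
    intro y v
    have := hpos (Φ y) (fderiv ℝ Φ y v)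
    rw [hHK] at this
    rwa [real_inner_comm]
  set q : E → ℝ := fun y => ‖S (Φ y + h) - S (Φ y)‖ ^ 2 + ‖S (Φ y + -h) - S (Φ y)‖ ^ 2 with hq
  set δ := (κ - A / r ^ 2) / 2 with hδdef
  have hδ : 0 < δ := by
    have : A / r ^ 2 < κ := by rw [div_lt_iff₀ (by positivity)]; exact hrA
    rw [hδdef]; linarith
  have h2 : ∀ y, (2 * r - τ * r ^ 2) * ‖h‖ ^ 2 < F (Φ y) → 2 * r ^ 2 * ‖h‖ ^ 2 ≤ q y := by
    intro y hy
    by_contra hlt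
    push Not at hlt
    have c1 := hco (Φ y) h
    have c2 := hco (Φ y) (-h)
    simp only [inner_neg_right, norm_neg] at c2
    simp only [hF] at hy
    simp only [hq] at hlt
    set p := ‖S (Φ y + h) - S (Φ y)‖ with hp
    set p' := ‖S (Φ y + -h) - S (Φ y)‖ with hp'
    have hp0 : 0 ≤ p := norm_nonneg _
    have hp0' : 0 ≤ p' := norm_nonneg _
    set N := ‖h‖
    set P := (p + p') / 2 with hP
    have hP2 : 2 * P ^ 2 ≤ p ^ 2 + p' ^ 2 := by rw [hP]; nlinarith [sq_nonneg (p - p')]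
    have hPr : P < r * N := by
      refine lt_of_pow_lt_pow_left₀ 2 (by positivity) ?_
      nlinarith
    have e1 : τ / 2 * (2 * P ^ 2) ≤ τ / 2 * (p ^ 2 + p' ^ 2) := by gcongr
    have e2 : τ * (r * N + P) ≤ 2 * N := by
      have : τ * (r * N + P) ≤ τ * (r * N + r * N) := by gcongr
      nlinarith
    have e3 : 0 ≤ (r * N - P) * (2 * N - τ * (r * N + P)) :=
      mul_nonneg (by linarith) (by linarith)
    have e4 : p + p' = 2 * P := by rw [hP]; ring
    have e5 : (p + p') * N = 2 * P * N := by rw [e4]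
    nlinarith
  have h3 : ∀ y, ‖gradient F (Φ y)‖ ^ 2 ≤ 2 * q y := by
    intro y
    rw [hgF]
    have e : S (Φ y + h) + S (Φ y + -h) - (2 : ℝ) • S (Φ y) =
        (S (Φ y + h) - S (Φ y)) + (S (Φ y + -h) - S (Φ y)) := by
      rw [two_smul]; abel
    simp only [hq, e]
    have := norm_add_le (S (Φ y + h) - S (Φ y)) (S (Φ y + -h) - S (Φ y))
    have h0 := norm_nonneg ((S (Φ y + h) - S (Φ y)) + (S (Φ y + -h) - S (Φ y)))
    nlinarith [sq_nonneg (‖S (Φ y + h) - S (Φ y)‖ - ‖S (Φ y + -h) - S (Φ y)‖)]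
  have h1 : ∀ y, (2 * r - τ * r ^ 2) * ‖h‖ ^ 2 < F (Φ y) → δ * q y ≤ LinearMap.trace ℝ E
      (((fderiv ℝ (gradient F) (Φ y)).comp (fderiv ℝ Φ y) : E →L[ℝ] E) : E →ₗ[ℝ] E)
        - ⟪gradient W y, gradient F (Φ y)⟫ := by
    intro y hy
    have hqy := h2 y hy
    set z := Φ y with hz
    have hSz : S z = y := hΦr y
    set K := fderiv ℝ Φ y with hKd
    have l1 := cf_logdet (fderiv ℝ S z) (fderiv ℝ S (z + h)) K (cf_hess_symm hψ z) (hpos z)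
      (cf_hess_symm hψ _) (hpos _) (hdet z) (hdet _) (hHK y)
    have l2 := cf_logdet (fderiv ℝ S z) (fderiv ℝ S (z + -h)) K (cf_hess_symm hψ z) (hpos z)
      (cf_hess_symm hψ _) (hpos _) (hdet z) (hdet _) (hHK y)
    have htr : LinearMap.trace ℝ E
        (((fderiv ℝ (gradient F) z).comp K : E →L[ℝ] E) : E →ₗ[ℝ] E) =
        LinearMap.trace ℝ E (((fderiv ℝ S (z + h)).comp K : E →L[ℝ] E) : E →ₗ[ℝ] E) +
        LinearMap.trace ℝ E (((fderiv ℝ S (z + -h)).comp K : E →L[ℝ] E) : E →ₗ[ℝ] E) -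
        2 * Module.finrank ℝ E := by
      have : (((fderiv ℝ (gradient F) z).comp K : E →L[ℝ] E) : E →ₗ[ℝ] E) =
          (((fderiv ℝ S (z + h)).comp K : E →L[ℝ] E) : E →ₗ[ℝ] E) +
          (((fderiv ℝ S (z + -h)).comp K : E →L[ℝ] E) : E →ₗ[ℝ] E) -
          (2 : ℝ) • LinearMap.id := by
        rw [hHF]
        ext v
        simp [hKd, hz, hHK]
      rw [this, map_sub, map_add, map_smul, LinearMap.trace_id, smul_eq_mul]
    have g1 := cf_taylor hg hghess z h
    have g2 := cf_taylor hg hghess z (-h)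
    simp only [inner_neg_right, norm_neg] at g2
    rw [hMA, hMA] at g1 g2
    have w1 := cf_taylor hW hWhess (S z) (S (z + h) - S z)
    have w2 := cf_taylor hW hWhess (S z) (S (z + -h) - S z)
    rw [add_sub_cancel] at w1 w2
    have hin : ⟪gradient W y, gradient F z⟫ =
        ⟪gradient W (S z), S (z + h) - S z⟫ + ⟪gradient W (S z), S (z + -h) - S z⟫ := by
      rw [hSz, hgF, ← inner_add_right]
      congr 1
      simp only [hSz]
      rw [two_smul]; abel
    rw [htr, hin]
    have hfin : δ * q y ≤ κ / 2 * q y - A * ‖h‖ ^ 2 := by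
      have : A * ‖h‖ ^ 2 ≤ A / r ^ 2 / 2 * q y := by
        calc A * ‖h‖ ^ 2 = A / r ^ 2 / 2 * (2 * r ^ 2 * ‖h‖ ^ 2) := by field_simp
          _ ≤ _ := by gcongr
      rw [hδdef]; linarith
    refine hfin.trans ?_
    simp only [hq, ← hz]
    linarith
  have := cf_maxprinciple hW hint hF2 hΦ hδ (by positivity : 0 < 2 * r ^ 2 * ‖h‖ ^ 2)
    hK h1 h2 h3 (S x)
  rw [hΦl] at this
  exact this

theorem cf_main {G W ψ : E → ℝ} {A κ M0 : ℝ} (hA : 0 < A) (hM0 : 0 < M0) (hκ : 0 < κ)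
    (hAκ : A = κ * M0 ^ 2)
    (hGpos : ∀ y, 0 < G y)
    (hGsmooth : ContDiff ℝ 2 fun y => Real.log (G y))
    (hGhess : ∀ y v, -A * ‖v‖ ^ 2 ≤ ⟪fderiv ℝ (gradient fun x => Real.log (G x)) y v, v⟫)
    (hW : ContDiff ℝ 2 W)
    (hWhess : ∀ x v, κ * ‖v‖ ^ 2 ≤ ⟪fderiv ℝ (gradient W) x v, v⟫)
    (hfin : IsFiniteMeasure ((volume : Measure E).withDensity
      fun x => ENNReal.ofReal (Real.exp (-W x))))
    (hψ : ContDiff ℝ 2 ψ) (hψconv : ConvexOn ℝ Set.univ ψ)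
    (hpush : Measure.map (fun y => gradient ψ y)
      ((volume : Measure E).withDensity fun y => ENNReal.ofReal (G y)) =
      (volume : Measure E).withDensity fun x => ENNReal.ofReal (Real.exp (-W x))) (y v : E) :
    ⟪fderiv ℝ (gradient ψ) y v, v⟫ ≤ M0 * ‖v‖ ^ 2 := by
  have hGc : Continuous G := by
    have : G = fun y => Real.exp (Real.log (G y)) := funext fun y => (Real.exp_log (hGpos y)).symm
    rw [this]
    exact Real.continuous_exp.comp hGsmooth.continuous
  have hWc := hW.continuous
  have hpos := cf_hess_nonneg hψ hψconv
  have hma := cf_monge_ampere hGpos hGc hWc hψ hpos hpush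
  have hdet : ∀ x, 0 < (fderiv ℝ (gradient ψ) x).det := by
    intro x
    have h1 := hGpos x
    rw [hma x] at h1
    exact pos_of_mul_pos_left h1 (Real.exp_pos _).le
  have hMA : ∀ x, Real.log (G x) = Real.log (fderiv ℝ (gradient ψ) x).det - W (gradient ψ x) := by
    intro x
    rw [hma x, Real.log_mul (hdet x).ne' (Real.exp_pos _).ne', Real.log_exp]; ring
  have hsurj := cf_surj hψ hpos
    (cf_dense_range (cf_contDiff_gradient hψ).continuous hWc hpush)
  obtain ⟨Φ, hΦ, hΦr, hΦl⟩ := cf_diffeo hψ hpos (fun x => (hdet x).ne') hsurj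
  have hint : Integrable fun y => Real.exp (-W y) := by
    refine ⟨(Real.continuous_exp.comp hWc.neg).aestronglyMeasurable, ?_⟩
    rw [hasFiniteIntegral_iff_ofReal (Filter.Eventually.of_forall fun y => (Real.exp_pos _).le)]
    have := hfin.measure_univ_lt_top
    rwa [withDensity_apply _ MeasurableSet.univ, Measure.restrict_univ] at this
  have step := fun {τ r : ℝ} => cf_step (τ := τ) (r := r) hGsmooth hW hψ hint hGhess hWhess hpos
    hdet hMA hΦ hΦr hΦl hA
  have hsq : ∀ r, M0 < r → A < κ * r ^ 2 := by
    intro r hr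
    rw [hAκ]
    gcongr
  set V : Set ℝ := {m | ∀ x v, ⟪fderiv ℝ (gradient ψ) x v, v⟫ ≤ m * ‖v‖ ^ 2} with hV
  by_cases hsmall : ∃ m ∈ V, m ≤ M0
  · obtain ⟨m, hm, hle⟩ := hsmall
    exact (hm y v).trans (by gcongr)
  push Not at hsmall
  have hne : V.Nonempty := by
    refine ⟨2 * (M0 + 1) - 0 * (M0 + 1) ^ 2, cf_second_diff hψ ?_⟩
    exact step le_rfl (by linarith) (hsq _ (by linarith)) (by simp) (cf_cocoercive0 hψ hpos)
  have hbdd : BddBelow V := ⟨M0, fun m hm => (hsmall m hm).le⟩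
  set M := sInf V with hM
  have hMV : M ∈ V := by
    intro x v
    by_cases hv : v = 0
    · simp [hv]
    have hv2 : 0 < ‖v‖ ^ 2 := by positivity
    rw [← div_le_iff₀ hv2]
    refine le_csInf hne fun m hm => ?_
    rw [div_le_iff₀ hv2]
    exact hm x v
  exfalso
  have hMM := hsmall M hMV
  have hMpos : 0 < M := hM0.trans hMM
  have hr1 : M0 < (M0 + M) / 2 := by linarith
  have hnew : 2 * ((M0 + M) / 2) - M⁻¹ * ((M0 + M) / 2) ^ 2 ∈ V := by
    refine cf_second_diff hψ ?_
    refine step (inv_pos.mpr hMpos).le (by linarith) (hsq _ hr1) ?_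
      (cf_cocoercive hψ hpos hMpos hMV)
    rw [inv_mul_le_iff₀ hMpos]; linarith
  have hle : M ≤ _ := csInf_le hbdd hnew
  have hlt : 0 < M⁻¹ * (M - (M0 + M) / 2) ^ 2 := by
    have : 0 < M - (M0 + M) / 2 := by linarith
    positivity
  have he : M⁻¹ * (M - (M0 + M) / 2) ^ 2 =
      M - (2 * ((M0 + M) / 2) - M⁻¹ * ((M0 + M) / 2) ^ 2) := by
    field_simp
    ring
  linarith

end Caff



/-- Caffarelli-type contraction bound: if `μ` has density `G` with
`−vᵀD²(log G)(y)v ≤ |v|²/(λ̄²(σ)T)`, `ν` is `κ`-strongly log-concave, and `ψ` is the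
convex Brenier potential with `(Dψ)_♯μ = ν`, then `λ̄(D²ψ) ≤ 1/√(λ̄²(σ)Tκ)`. -/
theorem stmt12 {n : ℕ}
    (σ : EuclideanSpace ℝ (Fin n) ≃L[ℝ] EuclideanSpace ℝ (Fin n))
    (hσsym : ∀ v w, ⟪σ v, w⟫ = ⟪v, σ w⟫)
    (hσpos : ∀ v, v ≠ 0 → 0 < ⟪σ v, v⟫)
    (T κ lam : ℝ) (hT : 0 < T) (hκ : 0 < κ)
    (hlam : ∀ v, ‖σ v‖ ≤ lam * ‖v‖) (hlamPos : 0 < lam)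
    (G : EuclideanSpace ℝ (Fin n) → ℝ) (hGpos : ∀ y, 0 < G y)
    (hGsmooth : ContDiff ℝ 2 fun y => Real.log (G y))
    (hGhess : ∀ y v, -⟪fderiv ℝ (gradient fun x => Real.log (G x)) y v, v⟫ ≤
      ‖v‖ ^ 2 / (lam ^ 2 * T))
    (W : EuclideanSpace ℝ (Fin n) → ℝ) (hW : ContDiff ℝ 2 W)
    (hWhess : ∀ x v, κ * ‖v‖ ^ 2 ≤ ⟪fderiv ℝ (gradient W) x v, v⟫)
    (μ ν : Measure (EuclideanSpace ℝ (Fin n)))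
    (hμ : μ = volume.withDensity fun y => ENNReal.ofReal (G y))
    (hν : ν = volume.withDensity fun x => ENNReal.ofReal (Real.exp (-W x)))
    (hμprob : IsProbabilityMeasure μ) (hνprob : IsProbabilityMeasure ν)
    (ψ : EuclideanSpace ℝ (Fin n) → ℝ) (hψ : ContDiff ℝ 2 ψ)
    (hψconv : ConvexOn ℝ Set.univ ψ)
    (hpush : Measure.map (fun y => gradient ψ y) μ = ν) :
    ∀ y v, ⟪fderiv ℝ (gradient ψ) y v, v⟫ ≤ (1 / Real.sqrt (lam ^ 2 * T * κ)) * ‖v‖ ^ 2 := by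
  subst hμ hν
  have hL : 0 < lam ^ 2 * T := by positivity
  have hLκ : 0 < lam ^ 2 * T * κ := by positivity
  intro y v
  refine cf_main (A := 1 / (lam ^ 2 * T)) (κ := κ) (by positivity)
    (by have := Real.sqrt_pos.mpr hLκ; positivity) hκ ?_ hGpos hGsmooth ?_ hW hWhess
    inferInstance hψ hψconv hpush y v
  · rw [div_pow, Real.sq_sqrt hLκ.le]
    field_simp
  · intro y v
    have := hGhess y v
    have e : ‖v‖ ^ 2 / (lam ^ 2 * T) = 1 / (lam ^ 2 * T) * ‖v‖ ^ 2 := by ring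
    rw [e] at this
    linarith
end
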